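/- arXiv:1706.01418 — 3 statements merged into one kernel-verified Lean document; each statement's English description precedes it below -/
import Mathlib

section
/- Assume the topology on X is Polish. Then there exists an optimistically universal inductive learning rule if and only if X is countable. -/
open MeasureTheory Filter Topology

/-- An inductive learning rule: a sequence of measurable functions
`f_n : X^n × Y^n × X → Y`. -/
def IsInductiveRule {X Y : Type*} [MeasurableSpace X] [MeasurableSpace Y]
    (f : ∀ n : ℕ, (Fin n → X) → (Fin n → Y) → X → Y) : Prop :=
  ∀ n : ℕ, Measurable fun p : (Fin n → X) × (Fin n → Y) × X => f n p.1 p.2.1 p.2.2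

/-- The long-run average loss `L̂_𝕏(f_n, f*; n)` of an inductive learning rule along the
path `x` (0-indexed, so `x 0, x 1, …` are `X_1, X_2, …`):
`limsup_{t→∞} (1/t) ∑_{m=n+1}^{n+t} ℓ(f_n(X_{1:n}, f*(X_{1:n}), X_m), f*(X_m))`. -/
noncomputable def indLoss {X Y : Type*} [PseudoMetricSpace Y]
    (f : ∀ n : ℕ, (Fin n → X) → (Fin n → Y) → X → Y)
    (fstar : X → Y) (n : ℕ) (x : ℕ → X) : ℝ :=
  Filter.limsup
    (fun t : ℕ =>
      (∑ s ∈ Finset.range t,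
          dist (f n (fun i => x i.1) (fun i => fstar (x i.1)) (x (n + s)))
            (fstar (x (n + s)))) / (t : ℝ))
    Filter.atTop

/-- Strong universal consistency of an inductive learning rule under the process with
law `μ`: for every measurable target `f*`, `L̂_𝕏(f_n, f*; n) → 0` almost surely. -/
def StronglyConsistentInd {X Y : Type*} [MeasurableSpace X] [MeasurableSpace Y]
    [PseudoMetricSpace Y] (μ : Measure (ℕ → X))
    (f : ∀ n : ℕ, (Fin n → X) → (Fin n → Y) → X → Y) : Prop :=
  ∀ fstar : X → Y, Measurable fstar →
    ∀ᵐ x ∂μ, Tendsto (fun n => indLoss f fstar n x) atTop (𝓝 0)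

/-- `SUIL`: the process with law `μ` admits strong universal inductive learning. -/
def SUIL {X : Type*} (Y : Type*) [MeasurableSpace X] [MeasurableSpace Y] [PseudoMetricSpace Y]
    (μ : Measure (ℕ → X)) : Prop :=
  ∃ f : ∀ n : ℕ, (Fin n → X) → (Fin n → Y) → X → Y,
    IsInductiveRule f ∧ StronglyConsistentInd μ f

open MeasureTheory Filter Topology

section prob
open ProbabilityTheory

variable {X : Type*} [MeasurableSpace X]

open Classical in
/-- mix two sequences: coordinates in `A` from the first one. -/
noncomputable def mixSeq (A : Set ℕ) (p : (ℕ → X) × (ℕ → X)) : ℕ → X :=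
  fun t => if t ∈ A then p.1 t else p.2 t

theorem measurable_mixSeq (A : Set ℕ) : Measurable (mixSeq (X := X) A) := by
  classical
  refine measurable_pi_lambda _ fun t => ?_
  unfold mixSeq
  by_cases h : t ∈ A
  · simp only [h, if_true]; fun_prop
  · simp only [h, if_false]; fun_prop

theorem map_mixSeq (ν : Measure X) [IsProbabilityMeasure ν] (A : Set ℕ) :
    ((Measure.infinitePi (fun _ : ℕ => ν)).prod (Measure.infinitePi (fun _ : ℕ => ν))).map
      (mixSeq A) = Measure.infinitePi (fun _ : ℕ => ν) := by
  classical
  refine Measure.eq_infinitePi _ ?_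
  intro s t ht
  rw [Measure.map_apply (measurable_mixSeq A) (MeasurableSet.pi s.countable_toSet (fun i _ => ht i))]
  have : mixSeq A ⁻¹' (Set.pi s t) =
      (Set.pi ((s.filter (· ∈ A) : Finset ℕ) : Set ℕ) t) ×ˢ
        (Set.pi ((s.filter (· ∉ A) : Finset ℕ) : Set ℕ) t) := by
    ext p
    simp only [Set.mem_preimage, Set.mem_pi, Set.mem_prod, mixSeq, Finset.mem_coe,
      Finset.mem_filter]
    constructor
    · intro h
      refine ⟨fun i hi => ?_, fun i hi => ?_⟩
      · have := h i hi.1; rwa [if_pos hi.2] at this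
      · have := h i hi.1; rwa [if_neg hi.2] at this
    · rintro ⟨h1, h2⟩ i hi
      by_cases hA : i ∈ A
      · rw [if_pos hA]; exact h1 i ⟨hi, hA⟩
      · rw [if_neg hA]; exact h2 i ⟨hi, hA⟩
  rw [this, Measure.prod_prod, Measure.infinitePi_pi _ (fun i _ => ht i),
    Measure.infinitePi_pi _ (fun i _ => ht i), Finset.prod_filter_mul_prod_filter_not]

theorem ae_mix_of_ae (ν : Measure X) [IsProbabilityMeasure ν] (A : Set ℕ) {p : (ℕ → X) → Prop}
    (h : ∀ᵐ ω ∂(Measure.infinitePi (fun _ : ℕ => ν)), p ω) :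
    ∀ᵐ ω ∂(Measure.infinitePi (fun _ : ℕ => ν)), ∀ᵐ ω' ∂(Measure.infinitePi (fun _ : ℕ => ν)),
      p (mixSeq A (ω, ω')) := by
  rw [← map_mixSeq ν A] at h
  exact Measure.ae_ae_of_ae_prod (ae_of_ae_map (measurable_mixSeq A).aemeasurable h)

theorem ae_of_ae_mix (ν : Measure X) [IsProbabilityMeasure ν] (A : Set ℕ) {p : (ℕ → X) → Prop}
    (hp : MeasurableSet {ω | p ω})
    (h : ∀ᵐ ω ∂(Measure.infinitePi (fun _ : ℕ => ν)),
      ∀ᵐ ω' ∂(Measure.infinitePi (fun _ : ℕ => ν)), p (mixSeq A (ω, ω'))) :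
    ∀ᵐ ω ∂(Measure.infinitePi (fun _ : ℕ => ν)), p ω := by
  rw [← map_mixSeq ν A, ae_map_iff (measurable_mixSeq A).aemeasurable hp]
  exact (Measure.ae_prod_iff_ae_ae (measurable_mixSeq A hp)).2 h

theorem iIndepFun_coord (ν : Measure X) [IsProbabilityMeasure ν] :
    iIndepFun (fun (t : ℕ) (ω : ℕ → X) => ω t) (Measure.infinitePi (fun _ : ℕ => ν)) :=
  iIndepFun_infinitePi (X := fun _ x => x) (fun _ => measurable_id)

theorem map_coord (ν : Measure X) [IsProbabilityMeasure ν] (t : ℕ) :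
    (Measure.infinitePi (fun _ : ℕ => ν)).map (fun ω : ℕ → X => ω t) = ν :=
  Measure.infinitePi_map_eval _ t

theorem integral_coord (ν : Measure X) [IsProbabilityMeasure ν] (t : ℕ) {h : X → ℝ}
    (hh : Measurable h) :
    ∫ ω, h (ω t) ∂(Measure.infinitePi (fun _ : ℕ => ν)) = ∫ x, h x ∂ν := by
  conv_rhs => rw [← map_coord ν t]
  rw [integral_map (measurable_pi_apply t).aemeasurable hh.aestronglyMeasurable]

theorem integrable_of_bdd (ν : Measure X) [IsProbabilityMeasure ν] {h : X → ℝ} {C : ℝ}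
    (hh : Measurable h) (h0 : ∀ x, 0 ≤ h x) (hC : ∀ x, h x ≤ C) : Integrable h ν :=
  Integrable.of_bound hh.aestronglyMeasurable C
    (Eventually.of_forall fun x => by rw [Real.norm_eq_abs, abs_of_nonneg (h0 x)]; exact hC x)

/-- enumerated SLLN -/
theorem slln_enum (ν : Measure X) [IsProbabilityMeasure ν] {h : X → ℝ} {C : ℝ}
    (hh : Measurable h) (h0 : ∀ x, 0 ≤ h x) (hC : ∀ x, h x ≤ C) (r : ℕ → ℕ)
    (hr : Function.Injective r) :
    ∀ᵐ ω ∂(Measure.infinitePi (fun _ : ℕ => ν)),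
      Tendsto (fun q : ℕ => (∑ j ∈ Finset.range q, h (ω (r j))) / q) atTop (𝓝 (∫ x, h x ∂ν)) := by
  have hm : ∀ j, Measurable (fun ω : ℕ → X => h (ω j)) := fun j => hh.comp (measurable_pi_apply j)
  have := strong_law_ae_real (μ := Measure.infinitePi (fun _ : ℕ => ν))
    (fun j ω => h (ω (r j))) (integrable_of_bdd _ (hm _) (fun _ => h0 _) (fun _ => hC _)) ?_ ?_
  · simpa only [integral_coord ν _ hh] using this
  · intro i j hij
    exact ((iIndepFun_coord ν).indepFun (hr.ne hij)).comp hh hh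
  · intro i
    have h1 : IdentDistrib (fun ω : ℕ → X => ω (r i)) (fun ω : ℕ → X => ω (r 0))
        (Measure.infinitePi (fun _ : ℕ => ν)) (Measure.infinitePi (fun _ : ℕ => ν)) :=
      ⟨(measurable_pi_apply _).aemeasurable, (measurable_pi_apply _).aemeasurable, by rw [map_coord, map_coord]⟩
    exact h1.comp hh

theorem sum_nth_count (R : ℕ → Prop) [DecidablePred R] (a : ℕ → ℝ) (N : ℕ) :
    ∑ u ∈ Finset.range N, (if R u then a u else 0) =
      ∑ j ∈ Finset.range (Nat.count R N), a (Nat.nth R j) := by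
  induction N with
  | zero => simp
  | succ N ih =>
    rw [Finset.sum_range_succ, ih, Nat.count_succ]
    by_cases h : R N
    · simp [h, Finset.sum_range_succ, Nat.nth_count h]
    · simp [h]

theorem tendsto_shift_avg {a : ℕ → ℝ}
    (h : Tendsto (fun N : ℕ => (∑ u ∈ Finset.range N, a u) / (N : ℝ)) atTop (𝓝 0)) (n : ℕ) :
    Tendsto (fun t : ℕ => (∑ u ∈ Finset.range t, a (n + u)) / (t : ℝ)) atTop (𝓝 0) := by
  have h1 : Tendsto (fun t : ℕ => (∑ u ∈ Finset.range (t + n), a u) / ((t + n : ℕ) : ℝ)) atTop (𝓝 0) :=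
    h.comp (tendsto_add_atTop_nat n)
  have h2 : Tendsto (fun t : ℕ => ((n : ℝ) / (t : ℝ))) atTop (𝓝 0) :=
    tendsto_const_div_atTop_nhds_zero_nat _
  have h3 : Tendsto (fun t : ℕ => ((∑ u ∈ Finset.range n, a u) / (t : ℝ))) atTop (𝓝 0) :=
    tendsto_const_div_atTop_nhds_zero_nat _
  have h4 := (h1.mul (h2.const_add 1)).sub h3
  simp only [add_zero, zero_mul, sub_zero] at h4
  refine h4.congr' ?_
  filter_upwards [eventually_gt_atTop 0] with t ht
  have ht' : (t : ℝ) ≠ 0 := by positivity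
  have ht2 : ((t + n : ℕ) : ℝ) ≠ 0 := by positivity
  rw [add_comm t n, Finset.sum_range_add]
  rw [add_comm t n] at ht2
  field_simp
  push_cast
  ring

/-- SLLN along a set of times -/
theorem slln_set (ν : Measure X) [IsProbabilityMeasure ν] {h : X → ℝ} {C : ℝ}
    (hh : Measurable h) (h0 : ∀ x, 0 ≤ h x) (hC : ∀ x, h x ≤ C) (R : ℕ → Prop) [DecidablePred R]
    (hR : (Set.ofPred R).Infinite) :
    ∀ᵐ ω ∂(Measure.infinitePi (fun _ : ℕ => ν)), ∀ n : ℕ,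
      Tendsto (fun t : ℕ => (∑ u ∈ Finset.range t,
        (if R (n + u) then h (ω (n + u)) - ∫ x, h x ∂ν else 0)) / (t : ℝ)) atTop (𝓝 0) := by
  filter_upwards [slln_enum ν hh h0 hC (Nat.nth R) (Nat.nth_injective hR)] with ω hω n
  refine tendsto_shift_avg (a := fun u => if R u then h (ω u) - ∫ x, h x ∂ν else 0) ?_ n
  have hc : Tendsto (fun N => Nat.count R N) atTop atTop := by
    refine tendsto_atTop_atTop.2 fun b => ⟨Nat.nth R b, fun N hN => ?_⟩
    calc b = Nat.count R (Nat.nth R b) := (Nat.count_nth_of_infinite hR b).symm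
      _ ≤ _ := Nat.count_monotone R hN
  have h1 := (hω.comp hc).sub_const (∫ x, h x ∂ν)
  rw [sub_self] at h1
  rw [tendsto_zero_iff_abs_tendsto_zero] at h1 ⊢
  refine squeeze_zero (fun _ => abs_nonneg _) (fun N => ?_) h1
  simp only [Function.comp]
  rw [sum_nth_count R (fun u => h (ω u) - ∫ x, h x ∂ν)]
  simp only [Finset.sum_sub_distrib, Finset.sum_const, Finset.card_range, nsmul_eq_mul]
  rcases Nat.eq_zero_or_pos (Nat.count R N) with h | h
  · simp [h]
  have hN : Nat.count R N ≤ N := Nat.count_le R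
  have hN' : (Nat.count R N : ℝ) ≤ N := by exact_mod_cast hN
  have hp : (0 : ℝ) < Nat.count R N := by exact_mod_cast h
  have key : ∀ S e c N : ℝ, 0 < c → c ≤ N → |(S - c * e) / N| ≤ |S / c - e| := by
    intro S e c N hc hN
    have : S / c - e = (S - c * e) / c := by field_simp
    rw [this, abs_div, abs_div, abs_of_pos hc, abs_of_pos (hc.trans_le hN)]
    gcongr
  exact key _ _ _ _ hp hN'

end prob

open MeasureTheory Filter Topology

section dens
variable {X Y : Type*} [MeasurableSpace X] [MeasurableSpace.CountablyGenerated X]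
    [MetricSpace Y] [TopologicalSpace.SeparableSpace Y] [Nonempty Y]
    [MeasurableSpace Y] [BorelSpace Y]

theorem exists_seq_dense_map {M Z : Type*} [PseudoMetricSpace Z] [SecondCountableTopology Z]
    [Nonempty M] (J : M → Z) : ∃ g : ℕ → M, ∀ m, ∀ ε > 0, ∃ i, dist (J (g i)) (J m) < ε := by
  let _ : PseudoMetricSpace M := PseudoMetricSpace.induced J inferInstance
  have : SecondCountableTopology M := TopologicalSpace.secondCountableTopology_induced _ _ J
  refine ⟨TopologicalSpace.denseSeq M, fun m ε hε => ?_⟩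
  obtain ⟨i, hi⟩ := (TopologicalSpace.denseRange_denseSeq M).exists_dist_lt m hε
  refine ⟨i, ?_⟩
  rw [dist_comm]
  exact hi

theorem exists_dense_functions_aux {E : Type*} [NormedAddCommGroup E]
    [TopologicalSpace.SeparableSpace E] (κ : Y → E) (hκ : Isometry κ)
    (ν : Measure X) [IsProbabilityMeasure ν]
    {C : ℝ} (hC : ∀ y₁ y₂ : Y, dist y₁ y₂ ≤ C) :
    ∃ g : ℕ → X → Y, (∀ i, Measurable (g i)) ∧
      ∀ f : X → Y, Measurable f → ∀ ε > 0, ∃ i, ∫ x, dist (g i x) (f x) ∂ν < ε := by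
  have : SecondCountableTopology Y := UniformSpace.secondCountable_of_separable Y
  obtain ⟨y₀⟩ := ‹Nonempty Y›
  have hmem : ∀ f : {f : X → Y // Measurable f}, MemLp (fun x => κ (f.1 x)) 1 ν := by
    intro f
    refine MemLp.of_bound (hκ.continuous.comp_stronglyMeasurable f.2.stronglyMeasurable).aestronglyMeasurable
      (C + ‖κ y₀‖) (Eventually.of_forall fun x => ?_)
    have h1 : dist (κ (f.1 x)) (κ y₀) ≤ C := by rw [hκ.dist_eq]; exact hC _ _
    have h2 := norm_le_norm_add_norm_sub' (κ (f.1 x)) (κ y₀)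
    rw [dist_eq_norm] at h1
    linarith
  let J : {f : X → Y // Measurable f} → Lp E 1 ν := fun f => (hmem f).toLp _
  have : Nonempty {f : X → Y // Measurable f} := ⟨⟨fun _ => y₀, measurable_const⟩⟩
  have : Fact ((1 : ENNReal) ≠ ⊤) := ⟨ENNReal.one_ne_top⟩
  obtain ⟨g, hg⟩ := exists_seq_dense_map J
  refine ⟨fun i => (g i).1, fun i => (g i).2, ?_⟩
  intro f hf ε hε
  obtain ⟨i, hi⟩ := hg ⟨f, hf⟩ ε hε
  refine ⟨i, ?_⟩
  refine lt_of_le_of_lt (le_of_eq ?_) hi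
  rw [dist_eq_norm, L1.norm_eq_integral_norm]
  refine integral_congr_ae ?_
  filter_upwards [Lp.coeFn_sub (J (g i)) (J ⟨f, hf⟩), (hmem (g i)).coeFn_toLp, (hmem ⟨f, hf⟩).coeFn_toLp]
    with x h1 h2 h3
  rw [h1, Pi.sub_apply, h2, h3, ← dist_eq_norm, hκ.dist_eq]

theorem exists_dense_functions (ν : Measure X) [IsProbabilityMeasure ν]
    {C : ℝ} (hC : ∀ y₁ y₂ : Y, dist y₁ y₂ ≤ C) :
    ∃ g : ℕ → X → Y, (∀ i, Measurable (g i)) ∧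
      ∀ f : X → Y, Measurable f → ∀ ε > 0, ∃ i, ∫ x, dist (g i x) (f x) ∂ν < ε := by
  have hsep :=
    TopologicalSpace.IsSeparable.span (R := ℝ)
      (TopologicalSpace.isSeparable_range (kuratowskiEmbedding.isometry Y).continuous)
  have := hsep.separableSpace
  exact exists_dense_functions_aux (E := Submodule.span ℝ (Set.range (kuratowskiEmbedding Y)))
    (fun y => ⟨kuratowskiEmbedding Y y, Submodule.subset_span ⟨y, rfl⟩⟩)
    (Isometry.of_dist_eq fun a b => (kuratowskiEmbedding.isometry Y).dist_eq a b) ν hC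

end dens

section conc
open ProbabilityTheory
variable {X : Type*} [MeasurableSpace X]

theorem cheb_avg (ν : Measure X) [IsProbabilityMeasure ν] {h : X → ℝ} {C : ℝ}
    (hh : Measurable h) (h0 : ∀ x, 0 ≤ h x) (hC : ∀ x, h x ≤ C) (r : ℕ → ℕ)
    (hr : Function.Injective r) (k : ℕ) :
    (Measure.infinitePi (fun _ : ℕ => ν)) {ω | (1/2 : ℝ) ^ k ≤
      |(∑ j ∈ Finset.range (16 ^ k), h (ω (r j))) / (16 ^ k : ℝ) - ∫ x, h x ∂ν|}
      ≤ ENNReal.ofReal (C ^ 2 * (1/4 : ℝ) ^ k) := by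
  set P := Measure.infinitePi (fun _ : ℕ => ν)
  have hm : ∀ j, Measurable (fun ω : ℕ → X => h (ω j)) := fun j => hh.comp (measurable_pi_apply j)
  have hL : ∀ j, MemLp (fun ω : ℕ → X => h (ω (r j))) 2 P := fun j =>
    MemLp.of_bound (hm _).aestronglyMeasurable C
      (Eventually.of_forall fun x => by rw [Real.norm_eq_abs, abs_of_nonneg (h0 _)]; exact hC _)
  let S : (ℕ → X) → ℝ := ∑ j ∈ Finset.range (16 ^ k), fun ω => h (ω (r j))
  have hS : ∀ ω, S ω = ∑ j ∈ Finset.range (16 ^ k), h (ω (r j)) := fun ω => by simp [S]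
  have hSL : MemLp S 2 P := memLp_finsetSum' _ fun j _ => hL j
  have hvar : variance S P ≤ 16 ^ k * C ^ 2 := by
    rw [IndepFun.variance_sum (fun j _ => hL j) (fun i _ j _ hij =>
      ((iIndepFun_coord ν).indepFun (hr.ne hij)).comp hh hh)]
    refine (Finset.sum_le_card_nsmul _ _ (C ^ 2) fun j _ => ?_).trans (by simp)
    refine (variance_le_sq_of_bounded (a := 0) (b := C)
      (Eventually.of_forall fun x => ⟨h0 _, hC _⟩) (hm _).aemeasurable).trans ?_
    nlinarith [sq_nonneg C]
  have hmean : ∫ ω, S ω ∂P = 16 ^ k * ∫ x, h x ∂ν := by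
    simp only [hS]
    rw [integral_finsetSum _ (fun j _ => integrable_of_bdd P (hm _) (fun _ => h0 _) (fun _ => hC _))]
    simp [P, integral_coord ν _ hh]
  have hpos : (0 : ℝ) < 16 ^ k * (1/2) ^ k := by positivity
  refine le_trans (measure_mono ?_) ((meas_ge_le_variance_div_sq hSL hpos).trans
    (ENNReal.ofReal_le_ofReal ?_))
  · intro ω hω
    simp only [Set.mem_ofPred_eq] at hω ⊢
    rw [hmean, hS]
    have : (∑ j ∈ Finset.range (16 ^ k), h (ω (r j))) - 16 ^ k * ∫ x, h x ∂ν =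
      16 ^ k * ((∑ j ∈ Finset.range (16 ^ k), h (ω (r j))) / (16 ^ k : ℝ) - ∫ x, h x ∂ν) := by
      field_simp
    rw [this, abs_mul, abs_of_pos (by positivity : (0:ℝ) < 16 ^ k)]
    gcongr
  · rw [div_le_iff₀ (by positivity)]
    refine hvar.trans (le_of_eq ?_)
    have : (16 : ℝ) ^ k = 4 ^ k * 4 ^ k := by rw [← mul_pow]; norm_num
    have h2 : (4 : ℝ) ^ k = 2 ^ k * 2 ^ k := by rw [← mul_pow]; norm_num
    rw [this, h2]
    simp only [one_div, inv_pow]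
    rw [h2]
    field_simp

theorem conc_ae (ν : Measure X) [IsProbabilityMeasure ν] {h : ℕ → X → ℝ} {C : ℝ}
    (hh : ∀ i, Measurable (h i)) (h0 : ∀ i x, 0 ≤ h i x) (hC : ∀ i x, h i x ≤ C) (r : ℕ → ℕ)
    (hr : Function.Injective r) :
    ∀ᵐ ω ∂(Measure.infinitePi (fun _ : ℕ => ν)), ∀ᶠ k : ℕ in atTop, ∀ i ≤ k,
      |(∑ j ∈ Finset.range (16 ^ k), h i (ω (r j))) / (16 ^ k : ℝ) - ∫ x, h i x ∂ν|
        < (1/2 : ℝ) ^ k := by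
  set P := Measure.infinitePi (fun _ : ℕ => ν)
  let A : ℕ → Set (ℕ → X) := fun k => ⋃ i ∈ Finset.range (k + 1), {ω | (1/2 : ℝ) ^ k ≤
      |(∑ j ∈ Finset.range (16 ^ k), h i (ω (r j))) / (16 ^ k : ℝ) - ∫ x, h i x ∂ν|}
  have hA : ∀ k, P (A k) ≤ ENNReal.ofReal (C ^ 2 * (1/2 : ℝ) ^ k) := by
    intro k
    refine (measure_biUnion_finset_le _ _).trans ?_
    refine (Finset.sum_le_card_nsmul _ _ _
      fun i _ => cheb_avg ν (hh i) (h0 i) (hC i) r hr k).trans ?_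
    rw [Finset.card_range, ← ENNReal.ofReal_nsmul]
    refine ENNReal.ofReal_le_ofReal ?_
    rw [nsmul_eq_mul]
    have h1 : ((k + 1 : ℕ) : ℝ) ≤ 2 ^ k := by exact_mod_cast Nat.lt_two_pow_self
    have h2 : (1/2 : ℝ) ^ k = 2 ^ k * (1/4) ^ k := by rw [← mul_pow]; norm_num
    rw [h2]
    have : 0 ≤ C ^ 2 * (1/4 : ℝ) ^ k := by positivity
    nlinarith
  have hsum : ∑' k, P (A k) ≠ ⊤ := by
    refine ne_top_of_le_ne_top ?_ (ENNReal.tsum_le_tsum hA)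
    refine Summable.tsum_ofReal_ne_top ?_
    exact (summable_geometric_of_lt_one (by norm_num) (by norm_num)).mul_left _
  filter_upwards [ae_eventually_notMem hsum] with ω hω
  filter_upwards [hω] with k hk i hi
  by_contra hcon
  exact hk (Set.mem_biUnion (Finset.mem_coe.2 (Finset.mem_range.2 (Nat.lt_succ_of_le hi))) (not_lt.1 hcon))

end conc

set_option linter.unusedSectionVars false

section meas
variable {X Y Ω : Type*} [MeasurableSpace X] [MeasurableSpace Ω]
    [PseudoMetricSpace Y] [SecondCountableTopology Y] [MeasurableSpace Y] [BorelSpace Y]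

theorem measurable_indLoss {f : ∀ n : ℕ, (Fin n → X) → (Fin n → Y) → X → Y}
    (hf : IsInductiveRule f) {F : Ω → X → Y} (hF : Measurable (fun p : Ω × X => F p.1 p.2))
    {x : Ω → ℕ → X} (hx : Measurable x) (n : ℕ) :
    Measurable (fun ω => indLoss f (F ω) n (x ω)) := by
  unfold indLoss
  refine Measurable.limsup fun t => ?_
  refine Measurable.div_const ?_ _
  refine Finset.measurable_fun_sum _ fun s _ => ?_
  have hxi : ∀ i, Measurable fun ω => x ω i := fun i => (measurable_pi_apply i).comp hx
  have hFi : ∀ i, Measurable fun ω => F ω (x ω i) := fun i => hF.comp (measurable_id.prodMk (hxi i))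
  refine Measurable.dist ?_ (hFi _)
  exact (hf n).comp (Measurable.prodMk (measurable_pi_lambda _ fun i => hxi i)
    (Measurable.prodMk (measurable_pi_lambda _ fun i => hFi i) (hxi _)))

/-- the averaged loss sequence is bounded by `C` -/
theorem avg_le {C : ℝ} {a : ℕ → ℝ} (hC : ∀ u, a u ≤ C) (hC0 : 0 ≤ C) (t : ℕ) :
    (∑ s ∈ Finset.range t, a s) / (t : ℝ) ≤ C := by
  refine div_le_of_le_mul₀ (by positivity) hC0 ?_
  refine (Finset.sum_le_card_nsmul _ _ C fun s _ => hC s).trans ?_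
  simp [mul_comm]

theorem avg_nonneg {a : ℕ → ℝ} (h : ∀ u, 0 ≤ a u) (t : ℕ) :
    0 ≤ (∑ s ∈ Finset.range t, a s) / (t : ℝ) :=
  div_nonneg (Finset.sum_nonneg fun s _ => h s) (by positivity)

theorem limsup_avg_le {a : ℕ → ℝ} {B : ℝ} (h0 : ∀ u, 0 ≤ a u)
    (h : ∀ᶠ t : ℕ in atTop, (∑ s ∈ Finset.range t, a s) / (t : ℝ) ≤ B) :
    limsup (fun t : ℕ => (∑ s ∈ Finset.range t, a s) / (t : ℝ)) atTop ≤ B :=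
  limsup_le_of_le (isCoboundedUnder_le_of_le atTop (x := 0) fun t => avg_nonneg h0 t) h

theorem le_limsup_avg {a : ℕ → ℝ} {B C : ℝ} (hC : ∀ u, a u ≤ C) (hC0 : 0 ≤ C)
    (h : ∃ᶠ t : ℕ in atTop, B ≤ (∑ s ∈ Finset.range t, a s) / (t : ℝ)) :
    B ≤ limsup (fun t : ℕ => (∑ s ∈ Finset.range t, a s) / (t : ℝ)) atTop :=
  le_limsup_of_frequently_le h (isBoundedUnder_of_eventually_le (a := C)
    (Eventually.of_forall fun t => avg_le hC hC0 t))

theorem indLoss_nonneg {C : ℝ} (hC : ∀ y₁ y₂ : Y, dist y₁ y₂ ≤ C)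
    (f : ∀ n : ℕ, (Fin n → X) → (Fin n → Y) → X → Y) (F : X → Y) (n : ℕ) (x : ℕ → X) :
    0 ≤ indLoss f F n x := by
  refine le_limsup_avg (fun _ => hC _ _) (dist_nonneg.trans (hC (F (x 0)) (F (x 0)))) ?_
  exact Eventually.frequently (Eventually.of_forall fun t => avg_nonneg (fun _ => dist_nonneg) t)

theorem indLoss_le {C : ℝ} (hC : ∀ y₁ y₂ : Y, dist y₁ y₂ ≤ C)
    (f : ∀ n : ℕ, (Fin n → X) → (Fin n → Y) → X → Y) (F : X → Y) (n : ℕ) (x : ℕ → X) :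
    indLoss f F n x ≤ C :=
  limsup_avg_le (fun _ => dist_nonneg)
    (Eventually.of_forall fun t => avg_le (fun _ => hC _ _) (dist_nonneg.trans (hC (F (x 0)) (F (x 0)))) t)
end meas

open MeasureTheory Filter Topology

set_option linter.unusedSectionVars false

section suil
variable {X Y : Type*} [MeasurableSpace X] [MeasurableSpace.CountablyGenerated X]
    [MeasurableSingletonClass X]
    [MetricSpace Y] [TopologicalSpace.SeparableSpace Y] [Nonempty Y]
    [MeasurableSpace Y] [BorelSpace Y]

open Classical in
/-- The path: the point `s` at times of type `none`, otherwise the coordinate of `ω`. -/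
noncomputable def seqX (s : X) (τ : ℕ → Option Bool) (ω : ℕ → X) : ℕ → X :=
  fun t => if τ t = none then s else ω t

theorem measurable_seqX (s : X) (τ : ℕ → Option Bool) : Measurable (seqX s τ) := by
  refine measurable_pi_lambda _ fun t => ?_
  unfold seqX
  by_cases h : τ t = none
  · simp only [h, if_true]; fun_prop
  · simp only [h, if_false]; fun_prop

/-- extension of a finite sequence by a default value -/
noncomputable def extFin {α : Type*} (d : α) {n : ℕ} (x : Fin n → α) (t : ℕ) : α :=
  if h : t < n then x ⟨t, h⟩ else d

theorem measurable_extFin {α : Type*} [MeasurableSpace α] (d : α) {n : ℕ} (t : ℕ) :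
    Measurable (fun x : Fin n → α => extFin d x t) := by
  unfold extFin
  by_cases h : t < n
  · simp only [h, dif_pos]; fun_prop
  · simp only [h]; simp

theorem extFin_eq {α : Type*} (d : α) {n : ℕ} (x : ℕ → α) {t : ℕ} (h : t < n) :
    extFin d (fun i : Fin n => x i) t = x t := by simp [extFin, h]

theorem ae_coord_ne (ν : Measure X) [IsProbabilityMeasure ν] [NullSingletonClass ν] (s : X) :
    ∀ᵐ ω ∂(Measure.infinitePi (fun _ : ℕ => ν)), ∀ t : ℕ, ω t ≠ s := by
  rw [ae_all_iff]
  intro t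
  have : ∀ᵐ x ∂((Measure.infinitePi (fun _ : ℕ => ν)).map (fun ω : ℕ → X => ω t)), x ≠ s := by
    rw [map_coord]
    exact (measure_eq_zero_iff_ae_notMem).1 (measure_singleton s)
  exact ae_of_ae_map (measurable_pi_apply t).aemeasurable this

theorem suil_of_types (ν : Measure X) [IsProbabilityMeasure ν] [NullSingletonClass ν] 
    {C : ℝ} (hC : ∀ y₁ y₂ : Y, dist y₁ y₂ ≤ C) (s : X)
    (τ : ℕ → Option Bool) (ρ : Bool) (ω : ℕ → X)
    (hR : (Set.ofPred (fun t => τ t = some ρ)).Infinite)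
    (hD : Tendsto (fun N : ℕ => (∑ u ∈ Finset.range N,
      (if τ u = some !ρ then (1 : ℝ) else 0)) / (N : ℝ)) atTop (𝓝 0)) :
    SUIL Y ((Measure.infinitePi (fun _ : ℕ => ν)).map
      (fun ω' => seqX s τ (mixSeq {t | τ t ≠ some ρ} (ω, ω')))) := by
  classical
  have : SecondCountableTopology Y := UniformSpace.secondCountable_of_separable Y
  obtain ⟨g, hg, hdense⟩ := exists_dense_functions (Y := Y) ν hC
  obtain ⟨y₀⟩ := ‹Nonempty Y›
  have hC0 : 0 ≤ C := dist_nonneg.trans (hC y₀ y₀)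
  set r : ℕ → ℕ := Nat.nth (fun t => τ t = some ρ) with hr
  have hrm : StrictMono r := Nat.nth_strictMono hR
  have hrR : ∀ j, τ (r j) = some ρ := fun j => Nat.nth_mem_of_infinite hR j
  obtain ⟨z0, hz0⟩ : ∃ z0, ∀ t, τ t = none → τ z0 = none := by
    by_cases h : ∃ t, τ t = none
    · obtain ⟨t, ht⟩ := h; exact ⟨t, fun _ _ => ht⟩
    · exact ⟨0, fun t ht => absurd ⟨t, ht⟩ h⟩
  let kk : ℕ → ℕ := fun n => Nat.findGreatest (fun k => r (16 ^ k) ≤ n) n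
  let emp : ∀ n : ℕ, ℕ → (Fin n → X) → (Fin n → Y) → ℝ := fun n i x y =>
    ∑ j ∈ Finset.range (16 ^ (kk n)), dist (g i (extFin s x (r j))) (extFin y₀ y (r j))
  have hex : ∀ (n : ℕ) (q : (Fin n → X) × (Fin n → Y)), ∃ i, i ≤ kk n ∧
      ∀ i' ≤ kk n, emp n i q.1 q.2 ≤ emp n i' q.1 q.2 := by
    intro n q
    obtain ⟨i, hi, hi'⟩ := Finset.exists_min_image (Finset.range (kk n + 1))
      (fun i => emp n i q.1 q.2) ⟨0, by simp⟩
    exact ⟨i, Nat.lt_succ_iff.1 (Finset.mem_range.1 hi), fun i' h' =>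
      hi' i' (Finset.mem_range.2 (Nat.lt_succ_of_le h'))⟩
  let sel : ∀ n : ℕ, (Fin n → X) × (Fin n → Y) → ℕ := fun n q => Nat.find (hex n q)
  have hempm : ∀ n i, Measurable (fun q : (Fin n → X) × (Fin n → Y) => emp n i q.1 q.2) := by
    intro n i
    refine Finset.measurable_fun_sum _ fun j _ => ?_
    exact Measurable.dist ((hg i).comp ((measurable_extFin _ _).comp measurable_fst))
      ((measurable_extFin _ _).comp measurable_snd)
  have hselm : ∀ n, Measurable (sel n) := by
    intro n
    refine measurable_find (hex n) fun k => ?_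
    refine (MeasurableSet.const _).inter ?_
    have : {q : (Fin n → X) × (Fin n → Y) | ∀ i' ≤ kk n, emp n k q.1 q.2 ≤ emp n i' q.1 q.2} =
      ⋂ i' ∈ Set.Iic (kk n), {q | emp n k q.1 q.2 ≤ emp n i' q.1 q.2} := by ext; simp
    have h2 : MeasurableSet {q : (Fin n → X) × (Fin n → Y) |
        ∀ i' ≤ kk n, emp n k q.1 q.2 ≤ emp n i' q.1 q.2} := by
      rw [this]
      exact MeasurableSet.biInter (Set.to_countable _) fun i' _ =>
        measurableSet_le (hempm n k) (hempm n i')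
    exact h2
  let rule : ∀ n : ℕ, (Fin n → X) → (Fin n → Y) → X → Y := fun n x y x' =>
    if x' = s then extFin y₀ y z0 else g (sel n (x, y)) x'
  have hrule : IsInductiveRule rule := by
    intro n
    refine Measurable.ite ?_ ?_ ?_
    · exact (measurableSet_singleton s).preimage (measurable_snd.comp measurable_snd)
    · exact (measurable_extFin y₀ z0).comp (measurable_fst.comp measurable_snd)
    · have h1 : Measurable (fun q : ℕ × X => g q.1 q.2) :=
        measurable_from_prod_countable_right fun i => hg i
      exact h1.comp (((hselm n).comp (measurable_fst.prodMk
        (measurable_fst.comp measurable_snd))).prodMk (measurable_snd.comp measurable_snd))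
  refine ⟨rule, hrule, ?_⟩
  intro fstar hf
  have hΦ : Measurable (fun ω' => seqX s τ (mixSeq {t | τ t ≠ some ρ} (ω, ω'))) :=
    (measurable_seqX s τ).comp ((measurable_mixSeq _).comp (by fun_prop))
  have hmm : MeasurableSet {x : ℕ → X | Tendsto (fun n => indLoss rule fstar n x) atTop (𝓝 0)} :=
    measurableSet_tendsto _ fun n =>
      measurable_indLoss hrule (F := fun _ => fstar) (hf.comp measurable_snd) measurable_id n
  rw [ae_map_iff hΦ.aemeasurable hmm]
  let h : ℕ → X → ℝ := fun i x => dist (g i x) (fstar x)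
  have hh : ∀ i, Measurable (h i) := fun i => (hg i).dist hf
  have h0 : ∀ i x, 0 ≤ h i x := fun i x => dist_nonneg
  have hhC : ∀ i x, h i x ≤ C := fun i x => hC _ _
  have hslln : ∀ᵐ ω' ∂(Measure.infinitePi (fun _ : ℕ => ν)), ∀ i, ∀ n : ℕ,
      Tendsto (fun t : ℕ => (∑ u ∈ Finset.range t,
        (if τ (n + u) = some ρ then h i (ω' (n + u)) - ∫ x, h i x ∂ν else 0)) / (t : ℝ))
        atTop (𝓝 0) := by
    rw [ae_all_iff]
    exact fun i => slln_set ν (hh i) (h0 i) (hhC i) (fun t => τ t = some ρ) hR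
  filter_upwards [conc_ae ν hh h0 hhC r hrm.injective, hslln, ae_coord_ne ν s] with ω' hconc hsl hne
  set x := seqX s τ (mixSeq {t | τ t ≠ some ρ} (ω, ω')) with hx
  have hxR : ∀ t, τ t = some ρ → x t = ω' t := by
    intro t ht
    simp [hx, seqX, mixSeq, ht]
  have hxN : ∀ t, τ t = none → x t = s := by
    intro t ht
    simp [hx, seqX, ht]
  have he0 : ∀ i, 0 ≤ ∫ x, h i x ∂ν := fun i => integral_nonneg (h0 i)
  have hkk : Tendsto kk atTop atTop := by
    refine tendsto_atTop_atTop.2 fun b => ⟨max b (r (16 ^ b)), fun n hn => ?_⟩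
    exact Nat.le_findGreatest ((le_max_left _ _).trans hn) ((le_max_right _ _).trans hn)
  rw [Metric.tendsto_nhds]
  intro ε hε
  obtain ⟨i0, hi0⟩ := hdense fstar hf (ε / 4) (by positivity)
  have hpow : Tendsto (fun k : ℕ => (1/2 : ℝ) ^ k) atTop (𝓝 0) :=
    tendsto_pow_atTop_nhds_zero_of_lt_one (by norm_num) (by norm_num)
  have hev := hkk.eventually (hconc.and ((eventually_ge_atTop (max i0 1)).and
    (hpow.eventually (gt_mem_nhds (by positivity : (0:ℝ) < ε / 16)))))
  filter_upwards [hev, eventually_gt_atTop z0] with n ⟨hn1, hn2, hn3⟩ hnz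
  rw [Real.dist_eq, sub_zero, abs_of_nonneg (indLoss_nonneg hC _ _ _ _)]
  have hrn : ∀ j < 16 ^ kk n, r j < n := by
    intro j hj
    have h1 : r (16 ^ kk n) ≤ n := Nat.findGreatest_of_ne_zero (P := fun k => r (16 ^ k) ≤ n) (n := n) rfl
      (by have := le_max_right i0 1; omega)
    exact (hrm hj).trans_le h1
  set q : (Fin n → X) × (Fin n → Y) := (fun i => x i.1, fun i => fstar (x i.1)) with hq
  have hemp : ∀ i, emp n i q.1 q.2 = ∑ j ∈ Finset.range (16 ^ (kk n)), h i (ω' (r j)) := by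
    intro i
    refine Finset.sum_congr rfl fun j hj => ?_
    have hj' := hrn j (Finset.mem_range.1 hj)
    rw [extFin_eq s x hj', extFin_eq y₀ (fun t => fstar (x t)) hj', hxR _ (hrR j)]
  obtain ⟨hs1, hs2⟩ := Nat.find_spec (hex n q)
  set m := sel n q with hm
  have hm1 : m ≤ kk n := hs1
  have hm2 : emp n m q.1 q.2 ≤ emp n i0 q.1 q.2 := hs2 i0 ((le_max_left _ _).trans hn2)
  have hem : ∫ x, h m x ∂ν < ε / 2 := by
    have a1 := abs_lt.1 (hn1 m hm1)
    have a2 := abs_lt.1 (hn1 i0 ((le_max_left _ _).trans hn2))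
    rw [hemp, hemp] at hm2
    have a3 : (∑ j ∈ Finset.range (16 ^ kk n), h m (ω' (r j))) / (16 ^ kk n : ℝ) ≤
      (∑ j ∈ Finset.range (16 ^ kk n), h i0 (ω' (r j))) / (16 ^ kk n : ℝ) := by gcongr
    change ∫ x, h i0 x ∂ν < ε / 4 at hi0
    linarith [a1.1, a2.2]
  refine lt_of_le_of_lt ?_ (show ε * (3/4) < ε by linarith)
  refine limsup_avg_le (fun _ => dist_nonneg) ?_
  have hlim := (hsl m n).add ((tendsto_shift_avg hD n).const_mul C)
  rw [mul_zero, add_zero] at hlim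
  filter_upwards [hlim.eventually (gt_mem_nhds (by positivity : (0:ℝ) < ε / 4)),
    eventually_gt_atTop 0] with t ht htpos
  have htp : (0:ℝ) < t := by exact_mod_cast htpos
  rw [div_le_iff₀ htp]
  have hpt : ∀ u, dist (rule n (fun i => x i.1) (fun i => fstar (x i.1)) (x (n + u))) (fstar (x (n + u)))
      ≤ (if τ (n + u) = some ρ then h m (ω' (n + u)) - ∫ x, h m x ∂ν else 0)
        + C * (if τ (n + u) = some !ρ then (1 : ℝ) else 0) + ∫ x, h m x ∂ν := by
    intro u
    rcases hτ : τ (n + u) with _ | b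
    · have hxs := hxN _ hτ
      have hzx := hxN _ (hz0 _ hτ)
      have : rule n (fun i => x i.1) (fun i => fstar (x i.1)) (x (n + u)) = fstar (x (n + u)) := by
        simp only [rule]
        rw [if_pos hxs, extFin_eq y₀ (fun t => fstar (x t)) hnz, hzx, hxs]
      rw [this, dist_self]
      simpa using he0 m
    · by_cases hb : b = ρ
      · subst hb
        have hxs := hxR _ hτ
        have : rule n (fun i => x i.1) (fun i => fstar (x i.1)) (x (n + u)) = g m (x (n + u)) := by
          simp only [rule]
          rw [if_neg (by rw [hxs]; exact hne _)]
        rw [this, hxs]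
        simp [h]
      · have hb' : b = !ρ := by cases b <;> cases ρ <;> simp_all
        subst hb'
        simp only [Option.some.injEq, Bool.not_eq_self, if_false, if_true]
        linarith [hC (rule n (fun i => x i.1) (fun i => fstar (x i.1)) (x (n + u))) (fstar (x (n + u))), he0 m]
  refine (Finset.sum_le_sum fun u _ => hpt u).trans ?_
  rw [Finset.sum_add_distrib, Finset.sum_add_distrib, ← Finset.mul_sum, Finset.sum_const,
    Finset.card_range, nsmul_eq_mul]
  have h5 : (∑ u ∈ Finset.range t,
        (if τ (n + u) = some ρ then h m (ω' (n + u)) - ∫ x, h m x ∂ν else 0)) +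
      C * (∑ u ∈ Finset.range t, (if τ (n + u) = some !ρ then (1 : ℝ) else 0)) < ε / 4 * t := by
    have := (mul_lt_mul_iff_left₀ htp).2 ht
    rw [add_mul, mul_assoc, div_mul_cancel₀ _ htp.ne', div_mul_cancel₀ _ htp.ne'] at this
    exact this
  nlinarith

end suil

open MeasureTheory Filter Topology

set_option linter.unusedSectionVars false

section lemM
variable {X Y : Type*} [MeasurableSpace X] [MeasurableSpace.CountablyGenerated X]
    [MeasurableSingletonClass X]
    [MetricSpace Y] [TopologicalSpace.SeparableSpace Y] [Nonempty Y]
    [MeasurableSpace Y] [BorelSpace Y]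

/-- Expected distance from the prediction to `y` at a fresh point. -/
noncomputable def genG (f : ∀ n : ℕ, (Fin n → X) → (Fin n → Y) → X → Y) (ν : Measure X) (s : X)
    (τ : ℕ → Option Bool) (lab : Option Bool → Y) (n : ℕ) (y : Y) (ω : ℕ → X) : ℝ :=
  ∫ x, dist (f n (fun i => seqX s τ ω i.1) (fun i => lab (τ i.1)) x) y ∂ν

theorem measurable_genDist {f : ∀ n : ℕ, (Fin n → X) → (Fin n → Y) → X → Y}
    (hf : IsInductiveRule f) (s : X)
    (τ : ℕ → Option Bool) (lab : Option Bool → Y) (n : ℕ) (y : Y) :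
    Measurable (fun p : (ℕ → X) × X =>
      dist (f n (fun i => seqX s τ p.1 i.1) (fun i => lab (τ i.1)) p.2) y) := by
  have : SecondCountableTopology Y := UniformSpace.secondCountable_of_separable Y
  refine Measurable.dist ?_ measurable_const
  have h1 : Measurable (fun p : (ℕ → X) × X => ((fun i : Fin n => seqX s τ p.1 i.1),
      ((fun i : Fin n => lab (τ i.1)), p.2))) := by
    refine Measurable.prodMk (measurable_pi_lambda _ fun i => ?_)
      (measurable_const.prodMk measurable_snd)
    exact (measurable_pi_apply i.1).comp ((measurable_seqX s τ).comp measurable_fst)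
  exact (hf n).comp h1

theorem measurable_genG {f : ∀ n : ℕ, (Fin n → X) → (Fin n → Y) → X → Y}
    (hf : IsInductiveRule f) (ν : Measure X) [IsProbabilityMeasure ν] (s : X)
    (τ : ℕ → Option Bool) (lab : Option Bool → Y) (n : ℕ) (y : Y) :
    Measurable (genG f ν s τ lab n y) :=
  ((measurable_genDist hf s τ lab n y).stronglyMeasurable.integral_prod_right (ν := ν)).measurable

theorem gen_slln {f : ∀ n : ℕ, (Fin n → X) → (Fin n → Y) → X → Y}
    (hf : IsInductiveRule f) (ν : Measure X) [IsProbabilityMeasure ν]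
    {C : ℝ} (hC : ∀ y₁ y₂ : Y, dist y₁ y₂ ≤ C) (s : X)
    (τ : ℕ → Option Bool) (lab : Option Bool → Y) (y : Y) (ρ : Bool)
    (hR : (Set.ofPred (fun t => τ t = some ρ)).Infinite) :
    ∀ᵐ ω ∂(Measure.infinitePi (fun _ : ℕ => ν)), ∀ n : ℕ,
      Tendsto (fun t : ℕ => (∑ u ∈ Finset.range t,
        (if τ (n + u) = some ρ then
          dist (f n (fun i => seqX s τ ω i.1) (fun i => lab (τ i.1)) (ω (n + u))) y
            - genG f ν s τ lab n y ω else 0)) / (t : ℝ)) atTop (𝓝 0) := by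
  rw [ae_all_iff]
  intro n
  refine ae_of_ae_mix ν {t | t < n} ?_ ?_
  · refine measurableSet_tendsto _ fun t => ?_
    refine Measurable.div_const ?_ _
    refine Finset.measurable_fun_sum _ fun u _ => ?_
    by_cases h : τ (n + u) = some ρ
    · simp only [h, if_true]
      refine Measurable.sub ?_ (measurable_genG hf ν s τ lab n y)
      exact (measurable_genDist hf s τ lab n y).comp
        (measurable_id.prodMk (measurable_pi_apply (n + u)))
    · simp only [h, if_false]; exact measurable_const
  · refine Eventually.of_forall fun ω => ?_
    have hm : Measurable (fun x => dist (f n (fun i => seqX s τ ω i.1) (fun i => lab (τ i.1)) x) y) :=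
      (measurable_genDist hf s τ lab n y).comp (measurable_const.prodMk measurable_id)
    filter_upwards [slln_set ν hm (fun _ => dist_nonneg) (fun _ => hC _ _)
      (fun t => τ t = some ρ) hR] with ω' hω'
    have h1 : (fun i : Fin n => seqX s τ (mixSeq {t | t < n} (ω, ω')) i.1) =
        fun i : Fin n => seqX s τ ω i.1 := by
      funext i; simp [seqX, mixSeq, i.2]
    have h2 : ∀ u, mixSeq {t | t < n} (ω, ω') (n + u) = ω' (n + u) := by
      intro u; simp [mixSeq]
    have h3 : genG f ν s τ lab n y (mixSeq {t | t < n} (ω, ω')) = genG f ν s τ lab n y ω := by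
      unfold genG; rw [h1]
    simp only [h1, h2, h3]
    exact hω' n

theorem gen_tendsto {f : ∀ n : ℕ, (Fin n → X) → (Fin n → Y) → X → Y}
    (hf : IsInductiveRule f)
    (hopt : ∀ μ : Measure (ℕ → X), IsProbabilityMeasure μ → SUIL Y μ → StronglyConsistentInd μ f)
    (ν : Measure X) [IsProbabilityMeasure ν] [NullSingletonClass ν]
    {C : ℝ} (hC : ∀ y₁ y₂ : Y, dist y₁ y₂ ≤ C) (s : X)
    (τ : ℕ → Option Bool) (lab : Option Bool → Y) (ρ : Bool)
    (hD : Tendsto (fun N : ℕ => (∑ u ∈ Finset.range N,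
      (if τ u = some !ρ then (1 : ℝ) else 0)) / (N : ℝ)) atTop (𝓝 0))
    {c : ℝ} (hc : 0 < c)
    (hR' : ∀ᶠ n : ℕ in atTop, ∃ᶠ t : ℕ in atTop, c * t ≤ ∑ u ∈ Finset.range t,
      (if τ (n + u) = some ρ then (1 : ℝ) else 0)) :
    ∀ᵐ ω ∂(Measure.infinitePi (fun _ : ℕ => ν)),
      Tendsto (fun n => genG f ν s τ lab n (lab (some ρ)) ω) atTop (𝓝 0) := by
  classical
  have : SecondCountableTopology Y := UniformSpace.secondCountable_of_separable Y
  have hC0 : 0 ≤ C := dist_nonneg.trans (hC (lab none) (lab none))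
  have hR : (Set.ofPred (fun t => τ t = some ρ)).Infinite := by
    rw [← Nat.frequently_atTop_iff_infinite, frequently_atTop]
    intro a
    obtain ⟨n, hn, hna⟩ := (hR'.and (eventually_ge_atTop a)).exists
    obtain ⟨t, ht, ht0⟩ := (hn.and_eventually (eventually_gt_atTop 0)).exists
    by_contra hcon
    push Not at hcon
    have : ∑ u ∈ Finset.range t, (if τ (n + u) = some ρ then (1 : ℝ) else 0) = 0 :=
      Finset.sum_eq_zero fun u _ => if_neg (hcon _ (by omega))
    rw [this] at ht
    have : (0:ℝ) < t := by exact_mod_cast ht0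
    nlinarith [mul_pos hc this]
  refine ae_of_ae_mix ν {t | τ t ≠ some ρ}
    (measurableSet_tendsto _ fun n => measurable_genG hf ν s τ lab n _) ?_
  filter_upwards [ae_mix_of_ae ν {t | τ t ≠ some ρ}
    (gen_slln hf ν hC s τ lab (lab (some ρ)) ρ hR), ae_coord_ne ν s] with ω hω hωs
  let fs : X → Y := fun x => if x = s then lab none else
    if x ∈ ω '' {t | τ t = some !ρ} then lab (some !ρ) else lab (some ρ)
  have hfs : Measurable fs := by
    refine Measurable.ite (measurableSet_singleton s) measurable_const
      (Measurable.ite ?_ measurable_const measurable_const)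
    exact ((Set.to_countable _).image ω).measurableSet
  have hΦ : Measurable (fun ω' => seqX s τ (mixSeq {t | τ t ≠ some ρ} (ω, ω'))) :=
    (measurable_seqX s τ).comp ((measurable_mixSeq _).comp (by fun_prop))
  have hcons := hopt _ (Measure.isProbabilityMeasure_map hΦ.aemeasurable)
    (suil_of_types (Y := Y) ν hC s τ ρ ω hR hD) fs hfs
  have hcons' := ae_of_ae_map hΦ.aemeasurable hcons
  have hne : ∀ᵐ ω' ∂(Measure.infinitePi (fun _ : ℕ => ν)), ∀ u t : ℕ, ω' t ≠ ω u :=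
    ae_all_iff.2 fun u => ae_coord_ne ν (ω u)
  filter_upwards [hω, hcons', hne, ae_coord_ne ν s] with ω' hs hcon hne hs'
  set w := mixSeq {t | τ t ≠ some ρ} (ω, ω') with hw
  have hlab : ∀ t, fs (seqX s τ w t) = lab (τ t) := by
    intro t
    rcases hτ : τ t with _ | b
    · simp [fs, seqX, hτ]
    · by_cases hb : b = ρ
      · subst hb
        have : seqX s τ w t = ω' t := by simp [seqX, hw, mixSeq, hτ]
        rw [this]
        have h2 : ω' t ∉ ω '' {t | τ t = some !b} := by
          rintro ⟨u, -, hu⟩; exact hne u t hu.symm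
        simp only [fs]
        rw [if_neg (hs' t), if_neg h2]
      · have hb' : b = !ρ := by cases b <;> cases ρ <;> simp_all
        subst hb'
        have : seqX s τ w t = ω t := by simp [seqX, hw, mixSeq, hτ]
        rw [this]
        simp only [fs]
        rw [if_neg (hωs t), if_pos ⟨t, hτ, rfl⟩]
  have hG0 : ∀ n, 0 ≤ genG f ν s τ lab n (lab (some ρ)) w := fun n =>
    integral_nonneg fun _ => dist_nonneg
  have key : ∀ᶠ n : ℕ in atTop, genG f ν s τ lab n (lab (some ρ)) w ≤
      indLoss f fs n (seqX s τ w) / c := by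
    filter_upwards [hR'] with n hn
    rw [le_div_iff₀ hc]
    refine le_of_forall_pos_le_add fun ε hε => ?_
    rw [← sub_le_iff_le_add]
    refine le_limsup_avg (fun _ => hC _ _) hC0 ?_
    refine (hn.and_eventually (((hs n).eventually (lt_mem_nhds (neg_lt_zero.2 hε))).and
      (eventually_gt_atTop 0))).mono ?_
    rintro t ⟨h1, h2, h3⟩
    have htp : (0:ℝ) < t := by exact_mod_cast h3
    rw [lt_div_iff₀ htp] at h2
    rw [le_div_iff₀ htp]
    simp only [hlab]
    set G := genG f ν s τ lab n (lab (some ρ)) w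
    have hpt : ∀ u, (if τ (n + u) = some ρ then
          dist (f n (fun i => seqX s τ w i.1) (fun i => lab (τ i.1)) (w (n + u))) (lab (some ρ))
            - G else 0) + G * (if τ (n + u) = some ρ then (1 : ℝ) else 0) ≤
        dist (f n (fun i => seqX s τ w i.1) (fun i => lab (τ i.1)) (seqX s τ w (n + u)))
          (lab (τ (n + u))) := by
      intro u
      by_cases h : τ (n + u) = some ρ
      · have : seqX s τ w (n + u) = w (n + u) := by simp [seqX, h]
        rw [this]; simp [h]
      · simp [h]
    refine le_trans ?_ (Finset.sum_le_sum fun u _ => hpt u)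
    rw [Finset.sum_add_distrib, ← Finset.mul_sum]
    have := mul_le_mul_of_nonneg_left h1 (hG0 n)
    nlinarith
  refine tendsto_of_tendsto_of_tendsto_of_le_of_le' tendsto_const_nhds ?_
    (Eventually.of_forall hG0) key
  simpa using hcon.div_const c

end lemM

open MeasureTheory Filter Topology

set_option linter.unusedSectionVars false

section hard
variable {X Y : Type*} [MeasurableSpace X] [MeasurableSpace.CountablyGenerated X]
    [MeasurableSingletonClass X]
    [MetricSpace Y] [TopologicalSpace.SeparableSpace Y] [Nonempty Y]
    [MeasurableSpace Y] [BorelSpace Y]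

theorem inMeasure_of_ae {Ω : Type*} [MeasurableSpace Ω] (P : Measure Ω) [IsProbabilityMeasure P]
    {G : ℕ → Ω → ℝ} (hG : ∀ n, Measurable (G n)) 
    (h : ∀ᵐ ω ∂P, Tendsto (fun n => G n ω) atTop (𝓝 0)) {ε : ℝ} (hε : 0 < ε) :
    Tendsto (fun n => P {ω | ε ≤ G n ω}) atTop (𝓝 0) := by
  have h1 := tendstoInMeasure_of_tendsto_ae (μ := P) (g := fun _ => (0:ℝ))
    (fun n => (hG n).aestronglyMeasurable) h
  rw [tendstoInMeasure_iff_dist] at h1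
  refine tendsto_of_tendsto_of_tendsto_of_le_of_le tendsto_const_nhds (h1 ε hε)
    (fun _ => zero_le) fun n => measure_mono fun ω hω => ?_
  simp only [Set.mem_ofPred_eq, Real.dist_eq, sub_zero] at hω ⊢
  exact hω.trans (le_abs_self _)

theorem sum_dvd_le (K : ℕ) (hK : 0 < K) (N : ℕ) :
    ∑ u ∈ Finset.range N, (if K ∣ u then (1:ℝ) else 0) ≤ (N:ℝ) / K + 1 := by
  rw [Finset.sum_boole]
  have : (Finset.range N).filter (fun u => K ∣ u) ⊆ (Finset.range (N / K + 1)).image (K * ·) := by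
    intro u hu
    simp only [Finset.mem_filter, Finset.mem_range, Finset.mem_image] at hu ⊢
    obtain ⟨hu, j, rfl⟩ := hu
    refine ⟨j, ?_, rfl⟩
    rw [Nat.lt_succ_iff, Nat.le_div_iff_mul_le hK, mul_comm]
    exact hu.le
  have h2 := (Finset.card_le_card this).trans Finset.card_image_le
  rw [Finset.card_range] at h2
  have h3 : (((N / K : ℕ)) : ℝ) ≤ (N:ℝ) / K := Nat.cast_div_le
  have h4 : ((((Finset.range N).filter (fun u => K ∣ u)).card : ℕ) : ℝ) ≤ ((N / K : ℕ) : ℝ) + 1 := by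
    exact_mod_cast h2
  linarith

theorem le_sum_dvd (K : ℕ) (hK : 0 < K) (n m : ℕ) :
    (m : ℝ) ≤ ∑ u ∈ Finset.range (K * m), (if K ∣ n + u then (1:ℝ) else 0) := by
  rw [Finset.sum_boole]
  obtain ⟨r, hr, hd⟩ : ∃ r < K, K ∣ n + r := by
    refine ⟨(n * (K - 1)) % K, Nat.mod_lt _ hK, Nat.dvd_of_mod_eq_zero ?_⟩
    rw [Nat.add_mod_mod]
    obtain ⟨K', rfl⟩ : ∃ K', K = K' + 1 := ⟨K - 1, by omega⟩
    have : n + n * (K' + 1 - 1) = n * (K' + 1) := by simp; ring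
    rw [this, Nat.mul_mod_left]
  have : (Finset.range m).image (fun j => K * j + r) ⊆
      (Finset.range (K * m)).filter (fun u => K ∣ n + u) := by
    intro u hu
    simp only [Finset.mem_filter, Finset.mem_range, Finset.mem_image] at hu ⊢
    obtain ⟨j, hj, rfl⟩ := hu
    constructor
    · calc K * j + r < K * (j + 1) := by rw [mul_add, mul_one]; omega
        _ ≤ K * m := Nat.mul_le_mul_left _ hj
    · have : n + (K * j + r) = (n + r) + K * j := by ring
      rw [this]
      exact dvd_add hd (dvd_mul_right _ _)
  have h2 := Finset.card_le_card this
  rw [Finset.card_image_of_injective, Finset.card_range] at h2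
  · exact_mod_cast h2
  · intro a b hab
    exact Nat.eq_of_mul_eq_mul_left hK (by simpa using hab)

theorem genG_congr (f : ∀ n : ℕ, (Fin n → X) → (Fin n → Y) → X → Y) (ν : Measure X) (s : X)
    {τ τ' : ℕ → Option Bool} (lab : Option Bool → Y) (n : ℕ) (h : ∀ i < n, τ i = τ' i) (y : Y) (ω : ℕ → X) :
    genG f ν s τ lab n y ω = genG f ν s τ' lab n y ω := by
  unfold genG
  have h1 : (fun i : Fin n => seqX s τ ω i.1) = fun i : Fin n => seqX s τ' ω i.1 := by
    funext i; simp [seqX, h i.1 i.2]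
  have h2 : (fun i : Fin n => lab (τ i.1)) = fun i : Fin n => lab (τ' i.1) := by
    funext i; simp [h i.1 i.2]
  rw [h1, h2]

theorem dist_le_genG {f : ∀ n : ℕ, (Fin n → X) → (Fin n → Y) → X → Y}
    (hf : IsInductiveRule f) (ν : Measure X) [IsProbabilityMeasure ν]
    {C : ℝ} (hC : ∀ y₁ y₂ : Y, dist y₁ y₂ ≤ C) (s : X)
    (τ : ℕ → Option Bool) (lab : Option Bool → Y) (n : ℕ) (y0 y1 : Y) (ω : ℕ → X) :
    dist y0 y1 ≤ genG f ν s τ lab n y0 ω + genG f ν s τ lab n y1 ω := by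
  unfold genG
  have hi : ∀ y, Integrable
      (fun x => dist (f n (fun i => seqX s τ ω i.1) (fun i => lab (τ i.1)) x) y) ν := fun y =>
    integrable_of_bdd ν ((measurable_genDist hf s τ lab n y).comp
      (measurable_const.prodMk measurable_id)) (fun _ => dist_nonneg) (fun _ => hC _ _)
  rw [← integral_add (hi _) (hi _)]
  calc dist y0 y1 = ∫ _x, dist y0 y1 ∂ν := by simp
    _ ≤ _ := integral_mono (integrable_const _) ((hi _).add (hi _))
      fun x => dist_triangle_left _ _ _

theorem step_exists {f : ∀ n : ℕ, (Fin n → X) → (Fin n → Y) → X → Y}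
    (hf : IsInductiveRule f)
    (hopt : ∀ μ : Measure (ℕ → X), IsProbabilityMeasure μ → SUIL Y μ → StronglyConsistentInd μ f)
    (ν : Measure X) [IsProbabilityMeasure ν] [NullSingletonClass ν]
    {C : ℝ} (hC : ∀ y₁ y₂ : Y, dist y₁ y₂ ≤ C) (s : X) (lab : Option Bool → Y)
    (hlab : 0 < dist (lab (some false)) (lab (some true)))
    (k b : ℕ) (τ : ℕ → Option Bool) (hτ : ∀ t ≥ b, τ t = if 2 ^ k ∣ t then some true else none) :
    ∃ n > b, 1 / 2 ≤ Measure.infinitePi (fun _ : ℕ => ν)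
      {ω | dist (lab (some false)) (lab (some true)) / 2 ≤
        genG f ν s τ lab n (lab (some false)) ω} := by
  set P := Measure.infinitePi (fun _ : ℕ => ν)
  set δ := dist (lab (some false)) (lab (some true)) with hδ
  have hK : 0 < 2 ^ k := by positivity
  have hKr : (0:ℝ) < 2 ^ k := by positivity
  have h1 := gen_tendsto hf hopt ν hC s τ lab true ?_ (c := 1 / 2 ^ k) (by positivity) ?_
  · have h2 := inMeasure_of_ae P (fun n => measurable_genG hf ν s τ lab n _) h1
      (ε := δ / 2) (by positivity)
    obtain ⟨n, hn, hnb⟩ := ((h2.eventually (gt_mem_nhds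
      (show (0 : ENNReal) < 1 / 2 by simp))).and (eventually_gt_atTop b)).exists
    refine ⟨n, hnb, ?_⟩
    have hms : MeasurableSet {ω | δ / 2 ≤ genG f ν s τ lab n (lab (some true)) ω} :=
      measurableSet_le measurable_const (measurable_genG hf ν s τ lab n _)
    have hsub : {ω | δ / 2 ≤ genG f ν s τ lab n (lab (some true)) ω}ᶜ ⊆
        {ω | δ / 2 ≤ genG f ν s τ lab n (lab (some false)) ω} := by
      intro ω hω
      simp only [Set.mem_compl_iff, Set.mem_ofPred_eq, not_le] at hω ⊢
      have := dist_le_genG hf ν hC s τ lab n (lab (some false)) (lab (some true)) ω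
      linarith
    refine le_trans ?_ (measure_mono hsub)
    rw [prob_compl_eq_one_sub hms]
    refine le_trans ?_ (tsub_le_tsub_left hn.le 1)
    simp
  · refine squeeze_zero (fun N => avg_nonneg (fun u => by split_ifs <;> simp) N) (fun N => ?_)
      (tendsto_const_div_atTop_nhds_zero_nat (b : ℝ))
    gcongr
    calc ∑ u ∈ Finset.range N, (if τ u = some !true then (1:ℝ) else 0)
        ≤ ∑ u ∈ Finset.range N, (if u < b then (1:ℝ) else 0) := by
          refine Finset.sum_le_sum fun u _ => ?_
          by_cases hu : u < b
          · simp only [hu, if_true]; split_ifs <;> simp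
          · rw [hτ u (not_lt.1 hu)]
            split_ifs <;> simp_all
      _ ≤ b := by
          rw [Finset.sum_boole]
          have : (Finset.range N).filter (fun u => u < b) ⊆ Finset.range b := by
            intro u; simp
          have := Finset.card_le_card this
          rw [Finset.card_range] at this
          exact_mod_cast this
  · filter_upwards [eventually_ge_atTop b] with n hn
    rw [frequently_atTop]
    intro a
    refine ⟨2 ^ k * a, Nat.le_mul_of_pos_left a hK, ?_⟩
    have h3 := le_sum_dvd (2 ^ k) hK n a
    calc 1 / 2 ^ k * ((2 ^ k * a : ℕ) : ℝ) = a := by push_cast; field_simp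
      _ ≤ _ := h3
      _ ≤ _ := by
        refine Finset.sum_le_sum fun u _ => ?_
        rw [hτ (n + u) (by omega)]
        split_ifs <;> simp_all

theorem no_rule {f : ∀ n : ℕ, (Fin n → X) → (Fin n → Y) → X → Y}
    (hf : IsInductiveRule f)
    (hopt : ∀ μ : Measure (ℕ → X), IsProbabilityMeasure μ → SUIL Y μ → StronglyConsistentInd μ f)
    (ν : Measure X) [IsProbabilityMeasure ν] [NullSingletonClass ν]
    {C : ℝ} (hC : ∀ y₁ y₂ : Y, dist y₁ y₂ ≤ C) (s : X) (lab : Option Bool → Y)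
    (hlab : 0 < dist (lab (some false)) (lab (some true))) : False := by
  classical
  set P := Measure.infinitePi (fun _ : ℕ => ν) with hP
  set δ := dist (lab (some false)) (lab (some true)) with hδ
  let good : (ℕ → Option Bool) → ℕ → Prop := fun τ n => 1 / 2 ≤ P
      {ω | δ / 2 ≤ genG f ν s τ lab n (lab (some false)) ω}
  have hstep : ∀ (k : ℕ) (q : ℕ × (ℕ → Option Bool)), ∃ n,
      (∀ t ≥ q.1, q.2 t = if 2 ^ k ∣ t then some true else none) → q.1 < n ∧ good q.2 n := by
    intro k q
    by_cases h : ∀ t ≥ q.1, q.2 t = if 2 ^ k ∣ t then some true else none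
    · obtain ⟨n, h1, h2⟩ := step_exists hf hopt ν hC s lab hlab k q.1 q.2 h
      exact ⟨n, fun _ => ⟨h1, h2⟩⟩
    · exact ⟨0, fun h' => absurd h' h⟩
  choose N hN using hstep
  let st : ℕ → ℕ × (ℕ → Option Bool) := fun k => Nat.rec
    (0, fun t => if 2 ^ 0 ∣ t then some true else none)
    (fun k q => (2 * N k q, fun t => if t < N k q then q.2 t else if t < 2 * N k q then some false
      else if 2 ^ (k + 1) ∣ t then some true else none)) k
  let n : ℕ → ℕ := fun k => N k (st k)
  let T : ℕ → ℕ → Option Bool := fun k => (st k).2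
  let b : ℕ → ℕ := fun k => (st k).1
  have hb : ∀ k, b (k + 1) = 2 * n k := fun k => rfl
  have hT : ∀ k t, T (k + 1) t = if t < n k then T k t else if t < 2 * n k then some false
      else if 2 ^ (k + 1) ∣ t then some true else none := fun k t => rfl
  have hinv : ∀ k, ∀ t ≥ b k, T k t = if 2 ^ k ∣ t then some true else none := by
    intro k
    cases k with
    | zero => intro t _; rfl
    | succ k =>
      intro t ht
      rw [hb] at ht
      rw [hT, if_neg (by omega), if_neg (by omega)]
  have hn : ∀ k, b k < n k ∧ good (T k) (n k) := fun k => hN k (st k) (hinv k)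
  have hnm : StrictMono n := strictMono_nat_of_lt_succ fun k => by
    have := (hn (k + 1)).1
    rw [hb] at this
    omega
  have hnk : ∀ k, k < n k := by
    intro k
    induction k with
    | zero => have := (hn 0).1; omega
    | succ k ih => have := hnm (Nat.lt_succ_self k); simp only [Nat.succ_eq_add_one] at this; omega
  have hagree : ∀ k j, k ≤ j → ∀ t < n k, T j t = T k t := by
    intro k j hkj
    induction j, hkj using Nat.le_induction with
    | base => intro t _; rfl
    | succ j hj ih =>
      intro t ht
      rw [hT, if_pos (ht.trans_le (hnm.monotone hj)), ih t ht]
  let τ : ℕ → Option Bool := fun t => T t t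
  have hτ : ∀ k, ∀ t < n k, τ t = T k t := by
    intro k t ht
    rcases le_total t k with h | h
    · exact (hagree t k h t (hnk t)).symm
    · exact hagree k t h t ht
  have htrue' : ∀ k j, k ≤ j → ∀ t ≥ b k, T j t = some true → 2 ^ k ∣ t := by
    intro k j hkj
    induction j, hkj using Nat.le_induction with
    | base =>
      intro t ht h
      rw [hinv k t ht] at h
      by_contra hc
      rw [if_neg hc] at h
      exact absurd h (by simp)
    | succ j hj ih =>
      intro t ht h
      rw [hT] at h
      split_ifs at h with h1 h2 h3
      · exact ih t ht h
      · exact absurd h (by simp)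
      · exact (pow_dvd_pow 2 (by omega)).trans h3
  have htrue : ∀ k, ∀ t ≥ b k, τ t = some true → 2 ^ k ∣ t := by
    intro k t ht h
    rw [hτ (max k t) t ((hnk t).trans_le (hnm.monotone (le_max_right _ _)))] at h
    exact htrue' k _ (le_max_left _ _) t ht h
  have hfalse : ∀ k t, n k ≤ t → t < 2 * n k → τ t = some false := by
    intro k t h1 h2
    rw [hτ (k + 1) t (by have := (hn (k + 1)).1; rw [hb] at this; omega), hT,
      if_neg (by omega), if_pos h2]
  have hlim := gen_tendsto hf hopt ν hC s τ lab false ?_ (c := 1 / 2) (by norm_num) ?_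
  · have h2 := inMeasure_of_ae P (fun n => measurable_genG hf ν s τ lab n _) hlim
      (ε := δ / 2) (by positivity)
    have h3 := h2.comp hnm.tendsto_atTop
    obtain ⟨k, hk⟩ := (h3.eventually (gt_mem_nhds (show (0 : ENNReal) < 1 / 2 by simp))).exists
    have h4 := (hn k).2
    simp only [good] at h4
    simp only [Function.comp] at hk
    have h5 : ∀ ω, genG f ν s τ lab (n k) (lab (some false)) ω =
        genG f ν s (T k) lab (n k) (lab (some false)) ω := fun ω =>
      genG_congr f ν s lab (n k) (hτ k) _ ω
    simp only [h5] at hk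
    exact absurd hk (not_lt.2 h4)
  · rw [Metric.tendsto_nhds]
    intro ε hε
    obtain ⟨k, hk⟩ := exists_pow_lt_of_lt_one (show (0:ℝ) < ε / 2 by positivity)
      (show (1/2:ℝ) < 1 by norm_num)
    have h1 : Tendsto (fun N : ℕ => ((b k : ℝ) + 1) / (N:ℝ)) atTop (𝓝 0) :=
      tendsto_const_div_atTop_nhds_zero_nat _
    filter_upwards [h1.eventually (gt_mem_nhds (show (0:ℝ) < ε / 2 by positivity)),
      eventually_gt_atTop 0] with M hM hM0
    have hMp : (0:ℝ) < M := by exact_mod_cast hM0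
    rw [Real.dist_eq, sub_zero, abs_of_nonneg (avg_nonneg (fun u => by split_ifs <;> simp) M),
      div_lt_iff₀ hMp]
    rw [div_lt_iff₀ hMp] at hM
    have h2 : ∑ u ∈ Finset.range M, (if τ u = some !false then (1:ℝ) else 0) ≤
        ∑ u ∈ Finset.range M, (if u < b k then (1:ℝ) else 0) +
        ∑ u ∈ Finset.range M, (if 2 ^ k ∣ u then (1:ℝ) else 0) := by
      rw [← Finset.sum_add_distrib]
      refine Finset.sum_le_sum fun u _ => ?_
      by_cases hu : u < b k
      · simp only [hu, if_true]; split_ifs <;> simp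
      · by_cases h : τ u = some true
        · have := htrue k u (not_lt.1 hu) h
          simp [hu, h, this]
        · simp only [Bool.not_false, h, if_false]; split_ifs <;> simp
    have h3 : ∑ u ∈ Finset.range M, (if u < b k then (1:ℝ) else 0) ≤ b k := by
      rw [Finset.sum_boole]
      have : (Finset.range M).filter (fun u => u < b k) ⊆ Finset.range (b k) := by
        intro u; simp
      have := Finset.card_le_card this
      rw [Finset.card_range] at this
      exact_mod_cast this
    have h4 := sum_dvd_le (2 ^ k) (by positivity) M
    have h5 : (M:ℝ) / ((2 ^ k : ℕ) : ℝ) = (1/2) ^ k * M := by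
      push_cast; rw [one_div, inv_pow]; field_simp
    rw [h5] at h4
    have h6 := mul_lt_mul_of_pos_right hk hMp
    linarith
  · refine Eventually.of_forall fun m => ?_
    rw [frequently_atTop]
    intro a
    have hk := hnk (m + a)
    set k := m + a with hkd
    refine ⟨2 * n k - m, by omega, ?_⟩
    have h1 : ((n k : ℕ) : ℝ) ≤ ∑ u ∈ Finset.range (2 * n k - m),
        (if τ (m + u) = some false then (1:ℝ) else 0) := by
      rw [Finset.sum_boole]
      have : Finset.Ico (n k - m) (2 * n k - m) ⊆
          (Finset.range (2 * n k - m)).filter (fun u => τ (m + u) = some false) := by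
        intro u hu
        simp only [Finset.mem_Ico, Finset.mem_filter, Finset.mem_range] at hu ⊢
        exact ⟨hu.2, hfalse k _ (by omega) (by omega)⟩
      have := Finset.card_le_card this
      rw [Nat.card_Ico] at this
      have h2 : n k ≤ ((Finset.range (2 * n k - m)).filter (fun u => τ (m + u) = some false)).card := by
        omega
      exact_mod_cast h2
    refine le_trans ?_ h1
    have h2 : ((2 * n k - m : ℕ) : ℝ) ≤ 2 * n k := by
      exact_mod_cast Nat.sub_le _ _
    linarith

theorem exists_atomless (Z : Type*) [TopologicalSpace Z] [PolishSpace Z] [MeasurableSpace Z]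
    [BorelSpace Z] (h : ¬ Countable Z) :
    ∃ ν : Measure Z, IsProbabilityMeasure ν ∧ NullSingletonClass ν := by
  have hR : ¬ Countable ℝ := by
    rw [← not_uncountable_iff, not_not]; infer_instance
  let e : ℝ ≃ᵐ Z := PolishSpace.measurableEquivOfNotCountable hR h
  let μ : Measure ℝ := volume.restrict (Set.Icc 0 1)
  have hμ : IsProbabilityMeasure μ := ⟨by simp [μ]⟩
  refine ⟨μ.map e, Measure.isProbabilityMeasure_map e.measurable.aemeasurable, ⟨fun x => ?_⟩⟩
  rw [e.map_apply]
  have : e ⁻¹' {x} = {e.symm x} := by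
    ext z; simp [e.eq_symm_apply]
  rw [this]
  exact measure_singleton _

end hard

open MeasureTheory Filter Topology

set_option linter.unusedSectionVars false

section easy
variable {X Y : Type*} [MeasurableSpace X] [Countable X]
    [MeasurableSingletonClass X]
    [MetricSpace Y] [TopologicalSpace.SeparableSpace Y] [Nonempty Y]
    [MeasurableSpace Y] [BorelSpace Y]

open Classical in
/-- The memorization rule. -/
noncomputable def memo (y₀ : Y) : ∀ n : ℕ, (Fin n → X) → (Fin n → Y) → X → Y :=
  fun _ x y x' => if h : ∃ i, x i = x' then y h.choose else y₀

theorem isInductiveRule_memo (y₀ : Y) : IsInductiveRule (memo (X := X) y₀) := by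
  intro n
  refine measurable_from_prod_countable_right fun x => ?_
  refine measurable_from_prod_countable_left fun x' => ?_
  by_cases h : ∃ i, x i = x'
  · simp only [memo, dif_pos h]; exact measurable_pi_apply _
  · simp only [memo, dif_neg h]; exact measurable_const

/-- The fair coin. -/
noncomputable def coin : Measure Bool :=
  (1 / 2 : ENNReal) • Measure.dirac true + (1 / 2 : ENNReal) • Measure.dirac false

instance instIsProbabilityMeasureCoin : IsProbabilityMeasure coin := ⟨by
  simp [coin, ENNReal.inv_two_add_inv_two]⟩

theorem map_not_coin : coin.map (fun b => !b) = coin := by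
  have hm : Measurable (fun b : Bool => !b) := measurable_of_countable _
  unfold coin
  rw [Measure.map_add _ _ hm, Measure.map_smul, Measure.map_smul, Measure.map_dirac' hm,
    Measure.map_dirac' hm, add_comm]
  rfl

open Classical in
/-- Flip one coordinate. -/
noncomputable def flipAt (a : X) (θ : X → Bool) : X → Bool :=
  fun x => (if x = a then (fun b => !b) else id) (θ x)

theorem measurable_flipAt (a : X) : Measurable (flipAt a) := by
  classical
  refine measurable_pi_lambda _ fun x => ?_
  unfold flipAt
  have : Measurable (if x = a then (fun b : Bool => !b) else id) := measurable_of_countable _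
  exact this.comp (measurable_pi_apply x)

theorem map_flipAt (a : X) :
    (Measure.infinitePi (fun _ : X => coin)).map (flipAt a) =
      Measure.infinitePi (fun _ : X => coin) := by
  classical
  have h := Measure.infinitePi_map_pi (μ := fun _ : X => coin)
    (f := fun x => if x = a then (fun b : Bool => !b) else id) (fun x => measurable_of_countable _)
  have h2 : (fun x : X => coin.map (if x = a then (fun b : Bool => !b) else id)) =
      fun _ => coin := by
    funext x
    by_cases hx : x = a
    · simp only [hx, if_true]; exact map_not_coin
    · simp only [hx, if_false]; exact Measure.map_id
  rw [h2] at h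
  exact h

/-- Random target. -/
noncomputable def tgt (y0 y1 : Y) (θ : X → Bool) (x : X) : Y := if θ x then y1 else y0

theorem measurable_tgt (y0 y1 : Y) (x : X) : Measurable (fun θ : X → Bool => tgt y0 y1 θ x) := by
  unfold tgt
  have : Measurable (fun b : Bool => if b then y1 else y0) := measurable_of_countable _
  exact this.comp (measurable_pi_apply x)

theorem measurable_loss {f : ∀ n : ℕ, (Fin n → X) → (Fin n → Y) → X → Y}
    (hf : IsInductiveRule f) (y0 y1 : Y) (n : ℕ) (x : Fin n → X) (a : X) :
    Measurable (fun θ : X → Bool => dist (f n x (fun i => tgt y0 y1 θ (x i)) a) (tgt y0 y1 θ a)) := by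
  have : SecondCountableTopology Y := UniformSpace.secondCountable_of_separable Y
  refine Measurable.dist ?_ (measurable_tgt y0 y1 a)
  have h1 : Measurable (fun θ : X → Bool => (x, ((fun i : Fin n => tgt y0 y1 θ (x i)), a))) :=
    measurable_const.prodMk ((measurable_pi_lambda _ fun i => measurable_tgt y0 y1 _).prodMk
      measurable_const)
  exact (hf n).comp h1

theorem half_le_loss {f : ∀ n : ℕ, (Fin n → X) → (Fin n → Y) → X → Y}
    (hf : IsInductiveRule f) {C : ℝ} (hC : ∀ y₁ y₂ : Y, dist y₁ y₂ ≤ C)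
    (y0 y1 : Y) (n : ℕ) (x : Fin n → X) (a : X) (ha : ∀ i, x i ≠ a) :
    dist y0 y1 / 2 ≤ ∫ θ, dist (f n x (fun i => tgt y0 y1 θ (x i)) a) (tgt y0 y1 θ a)
      ∂(Measure.infinitePi (fun _ : X => coin)) := by
  classical
  set Q := Measure.infinitePi (fun _ : X => coin)
  set g : (X → Bool) → ℝ := fun θ => dist (f n x (fun i => tgt y0 y1 θ (x i)) a) (tgt y0 y1 θ a)
    with hg
  have hgm : Measurable g := measurable_loss hf y0 y1 n x a
  have hgi : Integrable g Q := integrable_of_bdd Q hgm (fun _ => dist_nonneg) (fun _ => hC _ _)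
  have hgi2 : Integrable (fun θ => g (flipAt a θ)) Q :=
    integrable_of_bdd Q (hgm.comp (measurable_flipAt a)) (fun _ => dist_nonneg) (fun _ => hC _ _)
  have h1 : ∫ θ, g (flipAt a θ) ∂Q = ∫ θ, g θ ∂Q := by
    have hmap : Q.map (flipAt a) = Q := map_flipAt a
    conv_rhs => rw [← hmap]
    rw [integral_map (measurable_flipAt a).aemeasurable hgm.aestronglyMeasurable]
  have h2 : ∀ θ, dist y0 y1 ≤ g θ + g (flipAt a θ) := by
    intro θ
    have e1 : (fun i => tgt y0 y1 (flipAt a θ) (x i)) = fun i => tgt y0 y1 θ (x i) := by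
      funext i; simp [tgt, flipAt, ha i]
    simp only [hg, e1]
    have e2 : dist (tgt y0 y1 θ a) (tgt y0 y1 (flipAt a θ) a) = dist y0 y1 := by
      cases h : θ a <;> simp [tgt, flipAt, h, dist_comm]
    rw [← e2]
    exact dist_triangle_left _ _ _
  have h3 : dist y0 y1 ≤ ∫ θ, (g θ + g (flipAt a θ)) ∂Q := by
    calc dist y0 y1 = ∫ _θ, dist y0 y1 ∂Q := by simp
      _ ≤ _ := integral_mono (integrable_const _) (hgi.add hgi2) h2
  rw [integral_add hgi hgi2, h1] at h3
  linarith

theorem density_of_learn {f : ∀ n : ℕ, (Fin n → X) → (Fin n → Y) → X → Y}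
    (hf : IsInductiveRule f) {C : ℝ} (hC : ∀ y₁ y₂ : Y, dist y₁ y₂ ≤ C)
    (y0 y1 : Y) (hy : 0 < dist y0 y1) (ι : X → ℕ) (x : ℕ → X)
    (h : ∀ᵐ θ ∂(Measure.infinitePi (fun _ : X => coin)),
      Tendsto (fun n => indLoss f (tgt y0 y1 θ) n x) atTop (𝓝 0)) {ε : ℝ} (hε : 0 < ε) :
    ∃ k n : ℕ, ∀ᶠ t : ℕ in atTop,
      ∑ u ∈ Finset.range t, (if k ≤ ι (x (n + u)) then (1:ℝ) else 0) ≤ ε * t := by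
  classical
  have : SecondCountableTopology Y := UniformSpace.secondCountable_of_separable Y
  have hC0 : 0 ≤ C := dist_nonneg.trans (hC y0 y0)
  set Q := Measure.infinitePi (fun _ : X => coin) with hQ
  set δ := dist y0 y1 with hδ
  have hFm : Measurable (fun p : (X → Bool) × X => tgt y0 y1 p.1 p.2) :=
    measurable_from_prod_countable_left fun a => measurable_tgt y0 y1 a
  have hLm : ∀ n, Measurable (fun θ => indLoss f (tgt y0 y1 θ) n x) := fun n =>
    measurable_indLoss hf hFm measurable_const n
  have hL0 : ∀ n θ, 0 ≤ indLoss f (tgt y0 y1 θ) n x := fun n θ => indLoss_nonneg hC _ _ _ _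
  have hLC : ∀ n θ, indLoss f (tgt y0 y1 θ) n x ≤ C := fun n θ => indLoss_le hC _ _ _ _
  have hlim : Tendsto (fun n => ∫ θ, indLoss f (tgt y0 y1 θ) n x ∂Q) atTop (𝓝 0) := by
    have := tendsto_integral_of_dominated_convergence (μ := Q) (f := fun _ => (0:ℝ)) (fun _ => C)
      (fun n => (hLm n).aestronglyMeasurable) (integrable_const C)
      (fun n => Eventually.of_forall fun θ => by
        rw [Real.norm_eq_abs, abs_of_nonneg (hL0 n θ)]; exact hLC n θ) h
    simpa using this
  obtain ⟨n, hn⟩ := (hlim.eventually (gt_mem_nhds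
    (show (0:ℝ) < ε * (δ / 2) / 2 by positivity))).exists
  obtain ⟨k, hk⟩ : ∃ k, ∀ i < n, ι (x i) < k :=
    ⟨(Finset.range n).sup (fun i => ι (x i)) + 1, fun i hi =>
      Nat.lt_succ_of_le (Finset.le_sup (f := fun i => ι (x i)) (Finset.mem_range.2 hi))⟩
  refine ⟨k, n, ?_⟩
  let l : ℕ → (X → Bool) → ℝ := fun u θ =>
    dist (f n (fun i => x i.1) (fun i => tgt y0 y1 θ (x i.1)) (x (n + u))) (tgt y0 y1 θ (x (n + u)))
  have hlm : ∀ u, Measurable (l u) := fun u => measurable_loss hf y0 y1 n (fun i => x i.1) _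
  have hli : ∀ u, Integrable (l u) Q := fun u =>
    integrable_of_bdd Q (hlm u) (fun _ => dist_nonneg) (fun _ => hC _ _)
  let a : ℕ → (X → Bool) → ℝ := fun t θ => (∑ u ∈ Finset.range t, l u θ) / (t : ℝ)
  have ham : ∀ t, Measurable (a t) := fun t =>
    (Finset.measurable_fun_sum _ fun u _ => hlm u).div_const _
  have ha0 : ∀ t θ, 0 ≤ a t θ := fun t θ => avg_nonneg (fun _ => dist_nonneg) t
  have haC : ∀ t θ, a t θ ≤ C := fun t θ => avg_le (fun _ => hC _ _) hC0 t
  have hai : ∀ t, Integrable (a t) Q := fun t => integrable_of_bdd Q (ham t) (ha0 t) (haC t)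
  let L : (X → Bool) → ℝ := fun θ => indLoss f (tgt y0 y1 θ) n x
  have hLi : Integrable L Q := integrable_of_bdd Q (hLm n) (hL0 n) (hLC n)
  have hpos : Tendsto (fun t => ∫ θ, max (a t θ - L θ) 0 ∂Q) atTop (𝓝 0) := by
    have := tendsto_integral_of_dominated_convergence (μ := Q) (f := fun _ => (0:ℝ))
      (F := fun t θ => max (a t θ - L θ) 0) (fun _ => C)
      (fun t => (((ham t).sub (hLm n)).max measurable_const).aestronglyMeasurable)
      (integrable_const C)
      (fun t => Eventually.of_forall fun θ => by
        rw [Real.norm_eq_abs, abs_of_nonneg (le_max_right _ _)]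
        exact max_le (by linarith [haC t θ, hL0 n θ]) hC0)
      (Eventually.of_forall fun θ => by
        rw [Metric.tendsto_nhds]
        intro η hη
        have : ∀ᶠ t in atTop, a t θ < L θ + η :=
          eventually_lt_of_limsup_lt (f := atTop) (u := fun t => a t θ) (b := L θ + η)
            (lt_add_of_pos_right _ hη)
            (isBoundedUnder_of_eventually_le (a := C) (Eventually.of_forall fun t => haC t θ))
        filter_upwards [this] with t ht
        rw [Real.dist_eq, sub_zero, abs_of_nonneg (le_max_right _ _)]
        exact max_lt (by linarith) hη)
    simpa using this
  filter_upwards [hpos.eventually (gt_mem_nhds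
    (show (0:ℝ) < ε * (δ / 2) / 2 by positivity)), eventually_gt_atTop 0] with t ht ht0
  have htp : (0:ℝ) < t := by exact_mod_cast ht0
  have h1 : ∫ θ, a t θ ∂Q < ε * (δ / 2) := by
    have hmi : Integrable (fun θ => max (a t θ - L θ) 0) Q :=
      integrable_of_bdd Q (((ham t).sub (hLm n)).max measurable_const) (fun _ => le_max_right _ _)
        (C := C) (fun θ => max_le (by linarith [haC t θ, hL0 n θ]) hC0)
    have : ∫ θ, a t θ ∂Q ≤ ∫ θ, (L θ + max (a t θ - L θ) 0) ∂Q :=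
      integral_mono (hai t) (hLi.add hmi) fun θ => by
        have := le_max_left (a t θ - L θ) 0
        simp only
        linarith
    rw [integral_add hLi hmi] at this
    change ∫ θ, L θ ∂Q < _ at hn
    linarith
  have h2 : (δ / 2) * (∑ u ∈ Finset.range t, (if k ≤ ι (x (n + u)) then (1:ℝ) else 0)) / t ≤
      ∫ θ, a t θ ∂Q := by
    simp only [a]
    rw [integral_div, integral_finsetSum _ fun u _ => hli u, Finset.mul_sum]
    gcongr with u hu
    by_cases hku : k ≤ ι (x (n + u))
    · rw [if_pos hku, mul_one]
      refine half_le_loss hf hC y0 y1 n (fun i => x i.1) (x (n + u)) fun i hi => ?_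
      have := hk i.1 i.2
      rw [hi] at this
      omega
    · rw [if_neg hku, mul_zero]
      exact integral_nonneg fun _ => dist_nonneg
  have h3 := lt_of_le_of_lt h2 h1
  rw [div_lt_iff₀ htp] at h3
  have hδ2 : 0 < δ / 2 := by positivity
  refine le_of_mul_le_mul_left ?_ hδ2
  nlinarith

theorem memo_tendsto {C : ℝ} (hC : ∀ y₁ y₂ : Y, dist y₁ y₂ ≤ C) (y₀ : Y)
    (ι : X → ℕ) (hι : Function.Injective ι) (x : ℕ → X) (F : X → Y)
    (h : ∀ ε : ℝ, 0 < ε → ∃ k n : ℕ, ∀ᶠ t : ℕ in atTop,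
      ∑ u ∈ Finset.range t, (if k ≤ ι (x (n + u)) then (1:ℝ) else 0) ≤ ε * t) :
    Tendsto (fun n => indLoss (memo y₀) F n x) atTop (𝓝 0) := by
  classical
  have hC0 : 0 ≤ C := dist_nonneg.trans (hC y₀ y₀)
  rw [Metric.tendsto_nhds]
  intro ε hε
  obtain ⟨k, n0, hkn⟩ := h (ε / (4 * (C + 1))) (by positivity)
  obtain ⟨M, hM⟩ : ∃ M, ∀ t, ι (x t) < k → ∃ i < M, x i = x t := by
    have h1 : ∀ j, ∃ m, ∀ t, ι (x t) = j → ∃ i < m, x i = x t := by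
      intro j
      by_cases hj : ∃ t, ι (x t) = j
      · obtain ⟨t, ht⟩ := hj
        exact ⟨t + 1, fun t' ht' => ⟨t, Nat.lt_succ_self t, hι (ht.trans ht'.symm)⟩⟩
      · exact ⟨0, fun t ht => absurd ⟨t, ht⟩ hj⟩
    choose m hm using h1
    refine ⟨(Finset.range k).sup m, fun t ht => ?_⟩
    obtain ⟨i, hi, hi'⟩ := hm _ t rfl
    exact ⟨i, hi.trans_le (Finset.le_sup (f := m) (Finset.mem_range.2 ht)), hi'⟩
  filter_upwards [eventually_ge_atTop n0, eventually_ge_atTop M] with n hn0 hnM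
  rw [Real.dist_eq, sub_zero, abs_of_nonneg (indLoss_nonneg hC _ _ _ _)]
  refine lt_of_le_of_lt ?_ (show ε / 2 < ε by linarith)
  refine limsup_avg_le (fun _ => dist_nonneg) ?_
  obtain ⟨d, rfl⟩ := Nat.exists_eq_add_of_le hn0
  filter_upwards [(tendsto_add_atTop_nat d).eventually hkn, eventually_ge_atTop d,
    eventually_gt_atTop 0] with t ht htd ht0
  have htp : (0:ℝ) < t := by exact_mod_cast ht0
  rw [div_le_iff₀ htp]
  have hpt : ∀ u, dist (memo y₀ (n0 + d) (fun i => x i.1) (fun i => F (x i.1)) (x (n0 + d + u)))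
      (F (x (n0 + d + u))) ≤ C * (if k ≤ ι (x (n0 + (d + u))) then (1:ℝ) else 0) := by
    intro u
    rw [← add_assoc]
    by_cases hk : k ≤ ι (x (n0 + d + u))
    · rw [if_pos hk, mul_one]; exact hC _ _
    · rw [if_neg hk, mul_zero]
      obtain ⟨i, hi, hi'⟩ := hM _ (not_le.1 hk)
      have hex : ∃ i : Fin (n0 + d), x i.1 = x (n0 + d + u) := ⟨⟨i, hi.trans_le hnM⟩, hi'⟩
      have : memo y₀ (n0 + d) (fun i => x i.1) (fun i => F (x i.1)) (x (n0 + d + u)) =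
          F (x (n0 + d + u)) := by
        unfold memo
        rw [dif_pos hex]
        exact congrArg F hex.choose_spec
      rw [this, dist_self]
  refine (Finset.sum_le_sum fun u _ => hpt u).trans ?_
  rw [← Finset.mul_sum]
  have h2 : ∑ u ∈ Finset.range t, (if k ≤ ι (x (n0 + (d + u))) then (1:ℝ) else 0) ≤
      ∑ u ∈ Finset.range (t + d), (if k ≤ ι (x (n0 + u)) then (1:ℝ) else 0) := by
    rw [add_comm t d, Finset.sum_range_add]
    have : 0 ≤ ∑ u ∈ Finset.range d, (if k ≤ ι (x (n0 + u)) then (1:ℝ) else 0) :=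
      Finset.sum_nonneg fun u _ => by split_ifs <;> simp
    linarith
  have h3 : ((t + d : ℕ) : ℝ) ≤ 2 * t := by
    have : (t + d : ℕ) ≤ 2 * t := by omega
    exact_mod_cast this
  have h4 : ε / (4 * (C + 1)) * ((t + d : ℕ) : ℝ) ≤ ε / (4 * (C + 1)) * (2 * t) := by gcongr
  calc C * _ ≤ C * (ε / (4 * (C + 1)) * (2 * t)) := by
        gcongr; exact (h2.trans ht).trans h4
    _ ≤ (C + 1) * (ε / (4 * (C + 1)) * (2 * t)) := by gcongr; linarith
    _ = ε / 2 * t := by field_simp; ring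

theorem memo_consistent {C : ℝ} (hC : ∀ y₁ y₂ : Y, dist y₁ y₂ ≤ C) (y0 y1 : Y)
    (hy : 0 < dist y0 y1) (μ : Measure (ℕ → X)) [IsProbabilityMeasure μ] (hμ : SUIL Y μ) :
    StronglyConsistentInd μ (memo (X := X) y0) := by
  have : SecondCountableTopology Y := UniformSpace.secondCountable_of_separable Y
  obtain ⟨f, hf, hcons⟩ := hμ
  obtain ⟨ι, hι⟩ := exists_injective_nat X
  have hFm : Measurable (fun p : ((X → Bool) × (ℕ → X)) × X => tgt y0 y1 p.1.1 p.2) :=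
    measurable_from_prod_countable_left fun a => (measurable_tgt y0 y1 a).comp measurable_fst
  have hms : MeasurableSet {q : (X → Bool) × (ℕ → X) |
      Tendsto (fun n => indLoss f (tgt y0 y1 q.1) n q.2) atTop (𝓝 0)} :=
    measurableSet_tendsto _ fun n => measurable_indLoss hf hFm measurable_snd n
  have h1 : ∀ᵐ θ ∂(Measure.infinitePi (fun _ : X => coin)), ∀ᵐ x ∂μ,
      Tendsto (fun n => indLoss f (tgt y0 y1 θ) n x) atTop (𝓝 0) :=
    Eventually.of_forall fun θ => hcons _ (measurable_of_countable _)
  have h2 := (Measure.ae_ae_comm (p := fun θ x =>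
    Tendsto (fun n => indLoss f (tgt y0 y1 θ) n x) atTop (𝓝 0)) hms).1 h1
  intro F _
  filter_upwards [h2] with x hx
  exact memo_tendsto hC y0 ι hι x F fun ε hε => density_of_learn hf hC y0 y1 hy ι x hx hε

end easy


/-- **Corollary 24 (Hanneke).** For `X` Polish, there exists an optimistically universal
inductive learning rule if and only if `X` is countable. -/
theorem exists_optimistically_universal_inductive_iff_countable (X Y : Type*)
    [TopologicalSpace X] [PolishSpace X] [Nonempty X] [MeasurableSpace X] [BorelSpace X]
    [MetricSpace Y] [TopologicalSpace.SeparableSpace Y] [Nonempty Y]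
    [MeasurableSpace Y] [BorelSpace Y]
    (hbdd : ∃ C : ℝ, ∀ y₁ y₂ : Y, dist y₁ y₂ ≤ C)
    (hnontriv : ∃ y₁ y₂ : Y, 0 < dist y₁ y₂) :
    (∃ f : ∀ n : ℕ, (Fin n → X) → (Fin n → Y) → X → Y,
        IsInductiveRule f ∧
          ∀ μ : Measure (ℕ → X), IsProbabilityMeasure μ → SUIL Y μ →
            StronglyConsistentInd μ f) ↔
      Countable X := by
  classical
  obtain ⟨C, hC⟩ := hbdd
  obtain ⟨y0, y1, hy⟩ := hnontriv
  constructor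
  · rintro ⟨f, hf, hopt⟩
    by_contra hX
    obtain ⟨ν, hν1, hν2⟩ := exists_atomless X hX
    obtain ⟨s⟩ := ‹Nonempty X›
    exact no_rule hf hopt ν hC s (fun o => if o = some true then y1 else y0) (by simpa using hy)
  · intro hX
    exact ⟨memo y0, isInductiveRule_memo y0, fun μ hμ hs => memo_consistent hC y0 y1 hy μ hs⟩
end

section
/- For any process 𝕏 the following are each equivalent to Condition 1: (i) for every monotone sequence {A_k} in B with A_k ↓ ∅, lim_{k→∞} μ̂_𝕏(A_k) = 0 almost surely; (ii) for every sequence {A_k} in B, lim_{i→∞} μ̂_𝕏(∪_{k≥i} A_k) = μ̂_𝕏(limsup_{k→∞} A_k) almost surely; (iii) for every sequence {A_k} of pairwise disjoint sets in B, lim_{i→∞} μ̂_𝕏(∪_{k≥i} A_k) = 0 almost surely. -/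
open MeasureTheory Filter Topology

/-- The limsup of empirical averages of `g : X → ℝ` along the sequence `x`:
`μ̂_x(g) = limsup_{n→∞} (1/n) ∑_{t=1}^n g(x_t)`. -/
noncomputable def muHat {X : Type*} (x : ℕ → X) (g : X → ℝ) : ℝ :=
  Filter.limsup (fun n : ℕ => (∑ t ∈ Finset.range n, g (x t)) / (n : ℝ)) Filter.atTop

/-- The limsup empirical frequency of the set `A` along the sequence `x`:
`μ̂_x(A) = μ̂_x(1_A)`. -/
noncomputable def muHatSet {X : Type*} (x : ℕ → X) (A : Set X) : ℝ :=
  muHat x (A.indicator fun _ => (1 : ℝ))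

/-- Condition 1: for every monotone sequence `{A_k}` of measurable sets with `A_k ↓ ∅`,
`lim_{k→∞} E[μ̂_𝕏(A_k)] = 0`.  Here the process `𝕏` is represented by its law `μ` on the
path space `ℕ → X`, the coordinates being the random variables `X_t`. -/
def Condition1 {X : Type*} [MeasurableSpace X] (μ : Measure (ℕ → X)) : Prop :=
  ∀ A : ℕ → Set X, (∀ k, MeasurableSet (A k)) → Antitone A → (⋂ k, A k) = ∅ →
    Tendsto (fun k => ∫ x, muHatSet x (A k) ∂μ) atTop (𝓝 0)

section helpers
variable {X : Type*}

lemma aux_avg_nonneg (x : ℕ → X) (A : Set X) (n : ℕ) :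
    0 ≤ (∑ t ∈ Finset.range n, A.indicator (fun _ => (1 : ℝ)) (x t)) / (n : ℝ) :=
  div_nonneg (Finset.sum_nonneg fun t _ => Set.indicator_nonneg (fun _ _ => zero_le_one) _)
    (Nat.cast_nonneg n)

lemma aux_avg_le_one (x : ℕ → X) (A : Set X) (n : ℕ) :
    (∑ t ∈ Finset.range n, A.indicator (fun _ => (1 : ℝ)) (x t)) / (n : ℝ) ≤ 1 := by
  apply div_le_one_of_le₀ _ (Nat.cast_nonneg n)
  calc _ ≤ ∑ t ∈ Finset.range n, (1 : ℝ) :=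
        Finset.sum_le_sum fun t _ => Set.indicator_le_self' (fun _ _ => zero_le_one) _
    _ = n := by simp

lemma aux_bdd (x : ℕ → X) (A : Set X) :
    IsBoundedUnder (· ≤ ·) atTop (fun n : ℕ =>
      (∑ t ∈ Finset.range n, A.indicator (fun _ => (1 : ℝ)) (x t)) / (n : ℝ)) :=
  isBoundedUnder_of ⟨1, aux_avg_le_one x A⟩

lemma aux_bdd' (x : ℕ → X) (A : Set X) :
    IsBoundedUnder (· ≥ ·) atTop (fun n : ℕ =>
      (∑ t ∈ Finset.range n, A.indicator (fun _ => (1 : ℝ)) (x t)) / (n : ℝ)) :=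
  isBoundedUnder_of ⟨0, aux_avg_nonneg x A⟩

lemma aux_nonneg (x : ℕ → X) (A : Set X) : 0 ≤ muHatSet x A :=
  le_limsup_of_frequently_le (Frequently.of_forall (aux_avg_nonneg x A)) (aux_bdd x A)

lemma aux_le_one (x : ℕ → X) (A : Set X) : muHatSet x A ≤ 1 :=
  limsup_le_of_le (aux_bdd' x A).isCoboundedUnder_le (Eventually.of_forall (aux_avg_le_one x A))

lemma aux_mono (x : ℕ → X) {A B : Set X} (h : A ⊆ B) : muHatSet x A ≤ muHatSet x B := by
  refine limsup_le_limsup (Eventually.of_forall fun n => ?_)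
    (aux_bdd' x A).isCoboundedUnder_le (aux_bdd x B)
  exact div_le_div_of_nonneg_right (Finset.sum_le_sum fun t _ =>
    Set.indicator_le_indicator_of_subset h (fun _ => zero_le_one) _) (Nat.cast_nonneg n)

lemma aux_empty (x : ℕ → X) : muHatSet x ∅ = 0 := by
  simp [muHatSet, muHat]

lemma aux_diff (x : ℕ → X) {A B : Set X} (h : A ⊆ B) :
    muHatSet x B ≤ muHatSet x A + muHatSet x (B \ A) := by
  refine le_trans (le_of_eq ?_) (limsup_add_le (aux_bdd' x A) (aux_bdd x A)
    (aux_bdd' x (B \ A)).isCoboundedUnder_le (aux_bdd x (B \ A)))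
  unfold muHatSet muHat
  congr 1
  funext n
  simp only [Pi.add_apply]
  rw [← add_div, ← Finset.sum_add_distrib]
  congr 1
  refine Finset.sum_congr rfl fun t _ => ?_
  have := congrFun (Set.indicator_union_of_disjoint (Set.disjoint_sdiff_right (s := A) (t := B))
    (fun _ => (1 : ℝ))) (x t)
  rwa [Set.union_diff_cancel h] at this

lemma aux_meas [MeasurableSpace X] {A : Set X} (h : MeasurableSet A) :
    Measurable (fun x : ℕ → X => muHatSet x A) := by
  unfold muHatSet muHat
  refine Measurable.limsup fun n => ?_
  refine Measurable.div_const (Finset.measurable_sum _ fun t _ => ?_) _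
  exact (measurable_const.indicator h).comp (measurable_pi_apply t)

lemma aux_C1_i [MeasurableSpace X] (μ : Measure (ℕ → X)) [IsProbabilityMeasure μ] :
    Condition1 μ ↔
        ∀ A : ℕ → Set X, (∀ k, MeasurableSet (A k)) → Antitone A → (⋂ k, A k) = ∅ →
          ∀ᵐ x ∂μ, Tendsto (fun k => muHatSet x (A k)) atTop (𝓝 0) := by
  refine forall_congr' fun A => forall_congr' fun hm => forall_congr' fun ha =>
    forall_congr' fun _ => ?_
  have hb : ∀ k, ∀ᵐ x ∂μ, ‖muHatSet x (A k)‖ ≤ (1 : ℝ) := fun k => ae_of_all _ fun x => by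
    rw [Real.norm_of_nonneg (aux_nonneg x _)]; exact aux_le_one x _
  have hms : ∀ k, AEStronglyMeasurable (fun x => muHatSet x (A k)) μ := fun k =>
    (aux_meas (hm k)).aestronglyMeasurable
  constructor
  · intro h
    have hbb : ∀ x : ℕ → X, BddBelow (Set.range fun k => muHatSet x (A k)) := fun x =>
      ⟨0, by rintro _ ⟨k, rfl⟩; exact aux_nonneg x _⟩
    have hl : ∀ x : ℕ → X, Tendsto (fun k => muHatSet x (A k)) atTop
        (𝓝 (⨅ k, muHatSet x (A k))) := fun x =>
      tendsto_atTop_ciInf (fun i j hij => aux_mono x (ha hij)) (hbb x)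
    have h2 := tendsto_integral_of_dominated_convergence (μ := μ) (fun _ => (1 : ℝ)) hms
      (integrable_const _) hb (ae_of_all _ hl)
    have h0 := tendsto_nhds_unique h2 h
    have hn : ∀ x : ℕ → X, 0 ≤ ⨅ k, muHatSet x (A k) := fun x =>
      le_ciInf fun k => aux_nonneg x _
    have hi : Integrable (fun x : ℕ → X => ⨅ k, muHatSet x (A k)) μ := by
      refine Integrable.of_bound (C := 1)
        (aestronglyMeasurable_of_tendsto_ae atTop hms (ae_of_all _ hl)) (ae_of_all _ fun x => ?_)
      rw [Real.norm_of_nonneg (hn x)]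
      exact (ciInf_le (hbb x) 0).trans (aux_le_one x _)
    have := (integral_eq_zero_iff_of_nonneg hn hi).1 h0
    filter_upwards [this] with x hx
    have h3 := hl x
    simp only [Pi.zero_apply] at hx
    rwa [hx] at h3
  · intro h
    have h2 := tendsto_integral_of_dominated_convergence (μ := μ) (fun _ => (1 : ℝ)) hms
      (integrable_const _) hb h
    simpa using h2

lemma aux_i_ii [MeasurableSpace X] (μ : Measure (ℕ → X))
    (H : ∀ A : ℕ → Set X, (∀ k, MeasurableSet (A k)) → Antitone A → (⋂ k, A k) = ∅ →
          ∀ᵐ x ∂μ, Tendsto (fun k => muHatSet x (A k)) atTop (𝓝 0)) :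
    ∀ A : ℕ → Set X, (∀ k, MeasurableSet (A k)) →
          ∀ᵐ x ∂μ,
            Tendsto (fun i => muHatSet x (⋃ k ∈ Set.Ici i, A k)) atTop
              (𝓝 (muHatSet x (⋂ i, ⋃ k ∈ Set.Ici i, A k))) := by
  intro A hA
  have hB : ∀ i, MeasurableSet (⋃ k ∈ Set.Ici i, A k) := fun i =>
    MeasurableSet.biUnion (Set.to_countable _) fun k _ => hA k
  have hL := MeasurableSet.iInter hB
  have hanti : Antitone fun i => ⋃ k ∈ Set.Ici i, A k := fun i j hij =>
    Set.biUnion_subset_biUnion_left (Set.Ici_subset_Ici.2 hij)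
  have key := H (fun i => (⋃ k ∈ Set.Ici i, A k) \ (⋂ i, ⋃ k ∈ Set.Ici i, A k))
    (fun i => (hB i).diff hL) (fun i j hij => Set.diff_subset_diff_left (hanti hij)) (by
      ext y
      simp only [Set.mem_iInter, Set.mem_diff, Set.mem_empty_iff_false, iff_false]
      intro h
      exact (h 0).2 fun i => (h i).1)
  filter_upwards [key] with x hx
  refine tendsto_of_tendsto_of_tendsto_of_le_of_le tendsto_const_nhds
    (by simpa using hx.const_add (muHatSet x (⋂ i, ⋃ k ∈ Set.Ici i, A k)))
    (fun i => aux_mono x (Set.iInter_subset _ i)) (fun i => aux_diff x (Set.iInter_subset _ i))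

lemma aux_ii_iii [MeasurableSpace X] (μ : Measure (ℕ → X))
    (H : ∀ A : ℕ → Set X, (∀ k, MeasurableSet (A k)) →
          ∀ᵐ x ∂μ,
            Tendsto (fun i => muHatSet x (⋃ k ∈ Set.Ici i, A k)) atTop
              (𝓝 (muHatSet x (⋂ i, ⋃ k ∈ Set.Ici i, A k)))) :
    ∀ A : ℕ → Set X, (∀ k, MeasurableSet (A k)) →
          (Pairwise fun k l => Disjoint (A k) (A l)) →
          ∀ᵐ x ∂μ, Tendsto (fun i => muHatSet x (⋃ k ∈ Set.Ici i, A k)) atTop (𝓝 0) := by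
  intro A hA hd
  have he : (⋂ i, ⋃ k ∈ Set.Ici i, A k) = ∅ := by
    ext y
    simp only [Set.mem_iInter, Set.mem_iUnion, Set.mem_Ici, Set.mem_empty_iff_false, iff_false]
    intro h
    obtain ⟨k, -, hk⟩ := h 0
    obtain ⟨l, hl, hl'⟩ := h (k + 1)
    exact Set.disjoint_left.1 (hd (show k ≠ l by omega)) hk hl'
  have := H A hA
  simpa only [he, aux_empty] using this

lemma aux_iii_i [MeasurableSpace X] (μ : Measure (ℕ → X))
    (H : ∀ A : ℕ → Set X, (∀ k, MeasurableSet (A k)) →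
          (Pairwise fun k l => Disjoint (A k) (A l)) →
          ∀ᵐ x ∂μ, Tendsto (fun i => muHatSet x (⋃ k ∈ Set.Ici i, A k)) atTop (𝓝 0)) :
    ∀ A : ℕ → Set X, (∀ k, MeasurableSet (A k)) → Antitone A → (⋂ k, A k) = ∅ →
          ∀ᵐ x ∂μ, Tendsto (fun k => muHatSet x (A k)) atTop (𝓝 0) := by
  intro A hA ha he
  have hd : ∀ k l, k < l → Disjoint (A k \ A (k + 1)) (A l \ A (l + 1)) := fun k l hkl =>
    Set.disjoint_left.2 fun y hy hy' => hy.2 (ha (Nat.succ_le_of_lt hkl) hy'.1)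
  have key := H (fun k => A k \ A (k + 1)) (fun k => (hA k).diff (hA _)) (fun k l hkl => by
    rcases lt_or_gt_of_ne hkl with h | h
    · exact hd k l h
    · exact (hd l k h).symm)
  have hU : ∀ i, (⋃ k ∈ Set.Ici i, A k \ A (k + 1)) = A i := by
    intro i
    ext y
    simp only [Set.mem_iUnion, Set.mem_Ici, exists_prop]
    constructor
    · rintro ⟨k, hk, hy⟩
      exact ha hk hy.1
    · intro hy
      by_contra hc
      push Not at hc
      have hall : ∀ k, i ≤ k → y ∈ A k := fun k hk => by
        induction k, hk using Nat.le_induction with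
        | base => exact hy
        | succ k hk ih =>
          by_contra hn
          exact hc k hk ⟨ih, hn⟩
      have : y ∈ ⋂ k, A k := Set.mem_iInter.2 fun k =>
        ha (le_max_right i k) (hall _ (le_max_left i k))
      rw [he] at this
      exact this
  simpa only [hU] using key

end helpers

/-- **Lemma 10 (Hanneke).** Three conditions each equivalent to Condition 1. -/
theorem condition1_equivalents (X : Type*)
    [TopologicalSpace X] [TopologicalSpace.MetrizableSpace X]
    [TopologicalSpace.SeparableSpace X] [Nonempty X] [MeasurableSpace X] [BorelSpace X]
    (μ : Measure (ℕ → X)) (hμ : IsProbabilityMeasure μ) :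
    (Condition1 μ ↔
        ∀ A : ℕ → Set X, (∀ k, MeasurableSet (A k)) → Antitone A → (⋂ k, A k) = ∅ →
          ∀ᵐ x ∂μ, Tendsto (fun k => muHatSet x (A k)) atTop (𝓝 0)) ∧
    (Condition1 μ ↔
        ∀ A : ℕ → Set X, (∀ k, MeasurableSet (A k)) →
          ∀ᵐ x ∂μ,
            Tendsto (fun i => muHatSet x (⋃ k ∈ Set.Ici i, A k)) atTop
              (𝓝 (muHatSet x (⋂ i, ⋃ k ∈ Set.Ici i, A k)))) ∧
    (Condition1 μ ↔
        ∀ A : ℕ → Set X, (∀ k, MeasurableSet (A k)) →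
          (Pairwise fun k l => Disjoint (A k) (A l)) →
          ∀ᵐ x ∂μ, Tendsto (fun i => muHatSet x (⋃ k ∈ Set.Ici i, A k)) atTop (𝓝 0)) := by
  have h1 := aux_C1_i μ
  refine ⟨h1, ⟨fun h => aux_i_ii μ (h1.1 h), fun h => h1.2 (aux_iii_i μ (aux_ii_iii μ h))⟩,
    ⟨fun h => aux_ii_iii μ (aux_i_ii μ (h1.1 h)), fun h => h1.2 (aux_iii_i μ h)⟩⟩
end

section
/- Every process with convergent relative frequencies satisfies Condition 1, i.e., CRF ⊆ C1; moreover this inclusion is strict if and only if X has at least two elements. -/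
open MeasureTheory Filter Topology

/-- `CRF`: the process with law `μ` has convergent relative frequencies: for every
measurable `A`, `lim_{m→∞} (1/m) ∑_{t=1}^m 1_A(X_t)` exists almost surely. -/
def CRF {X : Type*} [MeasurableSpace X] (μ : Measure (ℕ → X)) : Prop :=
  ∀ A : Set X, MeasurableSet A →
    ∀ᵐ x ∂μ, ∃ L : ℝ,
      Tendsto
        (fun m : ℕ => (∑ t ∈ Finset.range m, A.indicator (fun _ => (1 : ℝ)) (x t)) / (m : ℝ))
        atTop (𝓝 L)

lemma nikodym_aux {X : Type*} [MeasurableSpace X] (ν : ℕ → Measure X)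
    [∀ n, IsFiniteMeasure (ν n)]
    (hc : ∀ A, MeasurableSet A → ∃ L : ℝ, Tendsto (fun n => (ν n).real A) atTop (𝓝 L))
    (A : ℕ → Set X) (hA : ∀ k, MeasurableSet (A k)) (hanti : Antitone A)
    (hemp : (⋂ k, A k) = ∅) (l : ℕ → ℝ)
    (hl : ∀ k, Tendsto (fun n => (ν n).real (A k)) atTop (𝓝 (l k))) :
    Tendsto l atTop (𝓝 0) := by
  have hl0 : ∀ k, 0 ≤ l k := fun k =>
    ge_of_tendsto' (hl k) (fun n => measureReal_nonneg)
  have hla : Antitone l := fun i j hij =>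
    le_of_tendsto_of_tendsto' (hl j) (hl i) (fun n => measureReal_mono (hanti hij))
  have hbdd : BddBelow (Set.range l) := ⟨0, by rintro _ ⟨k, rfl⟩; exact hl0 k⟩
  have hlim := tendsto_atTop_ciInf hla hbdd
  have hLle : ∀ k, (⨅ i, l i) ≤ l k := fun k => ciInf_le hbdd k
  have hL0 : 0 ≤ ⨅ i, l i := le_ciInf hl0
  generalize (⨅ i, l i) = L at hlim hLle hL0
  rcases hL0.eq_or_lt with h | hLpos
  · rwa [← h] at hlim
  exfalso
  obtain ⟨δ, hδ⟩ : ∃ δ, δ = L / 8 := ⟨_, rfl⟩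
  have hδpos : 0 < δ := by linarith
  obtain ⟨K0, hK0⟩ := (hlim.eventually (gt_mem_nhds (show L < L + δ by linarith))).exists
  obtain ⟨N0, hN0⟩ := eventually_atTop.1 ((hl K0).eventually (gt_mem_nhds hK0))
  have step : ∀ p : ℕ × ℕ, ∃ n, p.2 ≤ n ∧ ∃ k', p.1 < k' ∧ L - δ < (ν n).real (A p.1) ∧
      (ν n).real (A k') < δ := by
    rintro ⟨k, N⟩
    have h1 : ∀ᶠ n in atTop, L - δ < (ν n).real (A k) :=
      (hl k).eventually (lt_mem_nhds (by linarith [hLle k]))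
    obtain ⟨n, hn1, hn2⟩ := (h1.and (eventually_ge_atTop N)).exists
    have h2 : Tendsto (fun k => (ν n).real (A k)) atTop (𝓝 0) := by
      have := tendsto_measure_iInter_atTop (μ := ν n) (fun k => (hA k).nullMeasurableSet) hanti
        ⟨0, measure_ne_top _ _⟩
      rw [hemp, measure_empty] at this
      have := (ENNReal.tendsto_toReal ENNReal.zero_ne_top).comp this
      simpa [Measure.real, Function.comp_def] using this
    obtain ⟨k', hk1, hk2⟩ :=
      ((h2.eventually (gt_mem_nhds hδpos)).and (eventually_gt_atTop k)).exists
    exact ⟨n, hn2, k', hk2, hn1, hk1⟩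
  choose f hf g hg hfg1 hfg2 using step
  let p : ℕ → ℕ × ℕ := fun j => Nat.rec (K0, N0) (fun _ q => (g q, f q + 1)) j
  have p0 : p 0 = (K0, N0) := rfl
  have ps : ∀ j, p (j + 1) = (g (p j), f (p j) + 1) := fun j => rfl
  clear_value p
  have kmono : StrictMono (fun j => (p j).1) := strictMono_nat_of_lt_succ (fun j => by
    simp only [ps]; exact hg _)
  have nmono : StrictMono (fun j => f (p j)) := strictMono_nat_of_lt_succ (fun j => by
    have := hf (p (j + 1))
    rw [ps] at this ⊢
    exact this)
  have hnN : ∀ j, N0 ≤ f (p j) := fun j => by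
    have h := nmono.monotone (Nat.zero_le j)
    have h0 := hf (p 0)
    have : (p 0).2 = N0 := by rw [p0]
    omega
  let C : ℕ → Set X := fun j => A (p j).1
  have Canti : Antitone C := fun i j hij => hanti (kmono.monotone hij)
  have Cm : ∀ j, MeasurableSet (C j) := fun j => hA _
  have hC1 : ∀ j, L - δ < (ν (f (p j))).real (C j) := fun j => hfg1 _
  have hC2 : ∀ j, (ν (f (p j))).real (C (j + 1)) < δ := fun j => by
    have := hfg2 (p j)
    simpa only [C, ps] using this
  have hC0 : ∀ j, (ν (f (p j))).real (C 0) < L + δ := fun j => by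
    have := hN0 _ (hnN j)
    simp only [C, p0]
    linarith [this]
  have hD : ∀ j, L - 2 * δ < (ν (f (p j))).real (C j \ C (j + 1)) := fun j => by
    rw [measureReal_sdiff (Canti (Nat.le_succ j)) (Cm _)]
    linarith [hC1 j, hC2 j]
  let B : Set X := ⋃ i, C (2 * i) \ C (2 * i + 1)
  have Bm : MeasurableSet B := MeasurableSet.iUnion fun i => (Cm _).diff (Cm _)
  have hBeven : ∀ i, L - 2 * δ < (ν (f (p (2 * i)))).real B := fun i =>
    (hD (2 * i)).trans_le (measureReal_mono
      (Set.subset_iUnion (fun i => C (2 * i) \ C (2 * i + 1)) i))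
  have hBodd : ∀ i, (ν (f (p (2 * i + 1)))).real B < 3 * δ := fun i => by
    have hdisj : Disjoint B (C (2 * i + 1) \ C (2 * i + 1 + 1)) := by
      rw [Set.disjoint_left]
      rintro x hx ⟨hx1, hx2⟩
      obtain ⟨i', h1, h2⟩ := Set.mem_iUnion.1 hx
      rcases le_or_gt i' i with h | h
      · exact h2 (Canti (by omega) hx1)
      · exact hx2 (Canti (by omega) h1)
    have hsub : B ∪ (C (2 * i + 1) \ C (2 * i + 1 + 1)) ⊆ C 0 := by
      refine Set.union_subset (Set.iUnion_subset fun i => ?_) ?_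
      · exact Set.sdiff_subset.trans (Canti (Nat.zero_le _))
      · exact Set.sdiff_subset.trans (Canti (Nat.zero_le _))
    have h1 := measureReal_union (μ := ν (f (p (2 * i + 1)))) hdisj ((Cm _).diff (Cm _))
    have h2 := measureReal_mono (μ := ν (f (p (2 * i + 1)))) hsub
    linarith [hD (2 * i + 1), hC0 (2 * i + 1)]
  obtain ⟨M, hM⟩ := hc B Bm
  have he : Tendsto (fun i : ℕ => 2 * i) atTop atTop :=
    tendsto_atTop_mono (fun i => by simp only [id]; omega) tendsto_id
  have ho : Tendsto (fun i : ℕ => 2 * i + 1) atTop atTop :=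
    tendsto_atTop_mono (fun i => by simp only [id]; omega) tendsto_id
  have h1 : L - 2 * δ ≤ M :=
    ge_of_tendsto' (hM.comp (nmono.tendsto_atTop.comp he)) (fun i => (hBeven i).le)
  have h2 : M ≤ 3 * δ :=
    le_of_tendsto' (hM.comp (nmono.tendsto_atTop.comp ho)) (fun i => (hBodd i).le)
  linarith

lemma crf_cond1_aux {X : Type*} [MeasurableSpace X] (μ : Measure (ℕ → X))
    [IsProbabilityMeasure μ] (h : CRF μ) : Condition1 μ := by
  intro A hA hanti hemp
  let ν : ℕ → Measure X := fun n =>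
    ((n : NNReal)⁻¹) • ∑ t ∈ Finset.range n, μ.map (fun x : ℕ → X => x t)
  have hp : ∀ t : ℕ, IsProbabilityMeasure (μ.map (fun x : ℕ → X => x t)) := fun t =>
    Measure.isProbabilityMeasure_map (measurable_pi_apply t).aemeasurable
  have hfin : ∀ n, IsFiniteMeasure (ν n) := fun n => by
    have : IsFiniteMeasure (∑ t ∈ Finset.range n, μ.map (fun x : ℕ → X => x t)) := by
      infer_instance
    infer_instance
  have hind : ∀ B, MeasurableSet B → ∀ t : ℕ,
      Measurable (fun x : ℕ → X => B.indicator (fun _ => (1 : ℝ)) (x t)) := fun B hB t =>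
    (measurable_const.indicator hB).comp (measurable_pi_apply t)
  have hib : ∀ (B : Set X) (y : X), B.indicator (fun _ => (1 : ℝ)) y ∈ Set.Icc (0 : ℝ) 1 := by
    intro B y
    by_cases hy : y ∈ B <;> simp [hy]
  have hval : ∀ B, MeasurableSet B → ∀ n, (ν n).real B =
      ∫ x, (∑ t ∈ Finset.range n, B.indicator (fun _ => (1 : ℝ)) (x t)) / (n : ℝ) ∂μ := by
    intro B hB n
    rw [integral_div, integral_finsetSum]
    · have : ∀ t : ℕ, ∫ x, B.indicator (fun _ => (1 : ℝ)) (x t) ∂μ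
          = (μ.map (fun x : ℕ → X => x t)).real B := by
        intro t
        rw [map_measureReal_apply (measurable_pi_apply t) hB]
        rw [← integral_indicator_one (measurable_pi_apply t hB)]
        rfl
      simp only [this, ν]
      rw [measureReal_nnreal_smul_apply]
      simp only [Measure.real, Measure.coe_finsetSum, Finset.sum_apply]
      rw [ENNReal.toReal_sum (fun t _ => measure_ne_top _ _)]
      simp [div_eq_inv_mul]
    · intro t _
      refine Integrable.of_bound (hind B hB t).aestronglyMeasurable 1 (Eventually.of_forall ?_)
      intro x
      have := hib B (x t)
      rw [Real.norm_eq_abs, abs_of_nonneg this.1]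
      exact this.2
  have hconv : ∀ B, MeasurableSet B →
      Tendsto (fun n => (ν n).real B) atTop (𝓝 (∫ x, muHatSet x B ∂μ)) := by
    intro B hB
    simp only [hval B hB]
    refine tendsto_integral_of_dominated_convergence (fun _ => (1 : ℝ)) ?_ (integrable_const _)
      ?_ ?_
    · intro n
      exact ((Finset.measurable_sum _ (fun t _ => hind B hB t)).div_const _).aestronglyMeasurable
    · intro n
      refine Eventually.of_forall fun x => ?_
      have h0 : 0 ≤ ∑ t ∈ Finset.range n, B.indicator (fun _ => (1 : ℝ)) (x t) :=
        Finset.sum_nonneg fun t _ => (hib B (x t)).1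
      have h1 : ∑ t ∈ Finset.range n, B.indicator (fun _ => (1 : ℝ)) (x t) ≤ n := by
        have := Finset.sum_le_sum (s := Finset.range n) (fun t _ => (hib B (x t)).2)
        simpa using this
      rw [Real.norm_eq_abs, abs_of_nonneg (by positivity)]
      exact div_le_one_of_le₀ h1 (by positivity)
    · filter_upwards [h B hB] with x hx
      obtain ⟨L, hL⟩ := hx
      have : muHatSet x B = L := hL.limsup_eq
      rw [this]
      exact hL
  exact nikodym_aux ν (fun B hB => ⟨_, hconv B hB⟩) A hA hanti hemp _ (fun k => hconv _ (hA k))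

lemma strict_aux {X : Type*} [MeasurableSpace X] [MeasurableSingletonClass X] {a b : X}
    (hab : a ≠ b) :
    ∃ μ : Measure (ℕ → X), IsProbabilityMeasure μ ∧ Condition1 μ ∧ ¬ CRF μ := by
  classical
  let x : ℕ → X := fun t => if Even (Nat.log 2 t) then a else b
  refine ⟨Measure.dirac x, inferInstance, ?_, ?_⟩
  · intro A hA hanti hemp
    have key : ∀ y : X, ∃ k, y ∉ A k := fun y => by
      have : y ∉ ⋂ k, A k := by simp [hemp]
      simpa using this
    obtain ⟨ka, hka⟩ := key a
    obtain ⟨kb, hkb⟩ := key b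
    refine tendsto_const_nhds.congr' ?_
    filter_upwards [eventually_ge_atTop (max ka kb)] with k hk
    have ha : a ∉ A k := fun h => hka (hanti (le_trans (le_max_left _ _) hk) h)
    have hb : b ∉ A k := fun h => hkb (hanti (le_trans (le_max_right _ _) hk) h)
    have hx : ∀ t, x t ∉ A k := fun t => by
      simp only [x]; split_ifs <;> assumption
    rw [integral_dirac]
    simp [muHatSet, muHat, Set.indicator_of_notMem (hx _)]
  · intro h
    have h1 := h {a} (measurableSet_singleton a)
    rw [ae_dirac_eq] at h1
    obtain ⟨L, hL⟩ := h1
    let c : ℕ → ℝ := fun n => ∑ t ∈ Finset.range n,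
      ({a} : Set X).indicator (fun _ => (1 : ℝ)) (x t)
    have hL' : Tendsto (fun n => c n / n) atTop (𝓝 L) := hL
    have hpow : Tendsto (fun j : ℕ => 2 ^ j) atTop (atTop : Filter ℕ) :=
      tendsto_pow_atTop_atTop_of_one_lt (by norm_num)
    have h2 := hL'.comp hpow
    have h3 := h2.comp (tendsto_add_atTop_nat 1)
    have h4 := (h3.const_mul 2).sub h2
    have hdiff : ∀ j : ℕ, c (2 ^ (j + 1)) - c (2 ^ j) = if Even j then 2 ^ j else 0 := by
      intro j
      simp only [c]
      rw [← Finset.sum_Ico_eq_sub _ (Nat.pow_le_pow_right (by norm_num) (Nat.le_succ j))]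
      have : ∀ t ∈ Finset.Ico (2 ^ j) (2 ^ (j + 1)),
          ({a} : Set X).indicator (fun _ => (1 : ℝ)) (x t) = if Even j then 1 else 0 := by
        intro t ht
        rw [Finset.mem_Ico] at ht
        have hlog : Nat.log 2 t = j := Nat.log_eq_of_pow_le_of_lt_pow ht.1 ht.2
        simp only [x, hlog]
        split_ifs <;> simp [hab.symm]
      rw [Finset.sum_congr rfl this, Finset.sum_const, Nat.card_Ico]
      have h2 : 2 ^ (j + 1) - 2 ^ j = 2 ^ j := by rw [pow_succ]; omega
      rw [h2]
      split_ifs <;> simp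
    have h5 : Tendsto (fun j : ℕ => if Even j then (1 : ℝ) else 0) atTop (𝓝 L) := by
      have e : 2 * L - L = L := by ring
      rw [e] at h4
      refine h4.congr fun j => ?_
      have hp : (2 : ℝ) ^ j ≠ 0 := by positivity
      have : (if Even j then (1 : ℝ) else 0) = (c (2 ^ (j + 1)) - c (2 ^ j)) / 2 ^ j := by
        rw [hdiff]; split_ifs <;> simp
      rw [this]
      simp only [Function.comp_apply]
      push_cast
      field_simp
      ring
    have he : Tendsto (fun i : ℕ => 2 * i) atTop atTop :=
      tendsto_atTop_mono (fun i => by simp only [id]; omega) tendsto_id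
    have ho : Tendsto (fun i : ℕ => 2 * i + 1) atTop atTop :=
      tendsto_atTop_mono (fun i => by simp only [id]; omega) tendsto_id
    have e1 := h5.comp he
    have e2 := h5.comp ho
    have f1 : Tendsto (fun _ : ℕ => (1 : ℝ)) atTop (𝓝 L) := e1.congr (fun i => by simp)
    have f2 : Tendsto (fun _ : ℕ => (0 : ℝ)) atTop (𝓝 L) := e2.congr (fun i => by simp)
    have g1 := tendsto_nhds_unique f1 tendsto_const_nhds
    have g2 := tendsto_nhds_unique f2 tendsto_const_nhds
    linarith

lemma subsing_aux {X : Type*} [MeasurableSpace X] [Subsingleton X] (μ : Measure (ℕ → X)) :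
    CRF μ := by
  intro A _
  refine Eventually.of_forall fun x => ⟨A.indicator (fun _ => (1 : ℝ)) (x 0), ?_⟩
  refine tendsto_const_nhds.congr' ?_
  filter_upwards [eventually_gt_atTop 0] with n hn
  have : ∀ t, x t = x 0 := fun t => Subsingleton.elim _ _
  simp only [this, Finset.sum_const, Finset.card_range, nsmul_eq_mul]
  have : (n : ℝ) ≠ 0 := by positivity
  field_simp

/-- **Theorem 11 (Hanneke).** `CRF ⊆ C1`, and the inclusion is strict iff `X` has at
least two elements. -/
theorem CRF_subset_condition1 (X : Type*)
    [TopologicalSpace X] [TopologicalSpace.MetrizableSpace X]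
    [TopologicalSpace.SeparableSpace X] [Nonempty X] [MeasurableSpace X] [BorelSpace X] :
    (∀ μ : Measure (ℕ → X), IsProbabilityMeasure μ → CRF μ → Condition1 μ) ∧
    ((∃ μ : Measure (ℕ → X), IsProbabilityMeasure μ ∧ Condition1 μ ∧ ¬ CRF μ) ↔
      Nontrivial X) := by
  refine ⟨fun μ hμ h => crf_cond1_aux μ h, ?_, ?_⟩
  · rintro ⟨μ, _, _, h⟩
    by_contra hn
    rw [not_nontrivial_iff_subsingleton] at hn
    exact h (subsing_aux μ)
  · rintro ⟨a, b, hab⟩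
    exact strict_aux hab
end
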